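/- arXiv:2401.08208 — 3 statements merged into one kernel-verified Lean document; each statement's English description precedes it below -/
import Mathlib

section
/- Let k ≥ 3 and 𝔸 a finite multiset of positive integers with distinct values a_1 < ... < a_k, multiplicities r_i ≥ 2 for all i, gcd(a_1, ..., a_k) = 1, r = min_i r_i, and let α be a positive integer with α < Σ_{i=1}^k r_i - r. Then there exists m ∈ [1, k] with Σ_{i=1}^{m-1} r_i ≤ α < Σ_{i=1}^{m} r_i and |S_α(𝔸)| ≥ |(r-1)(A ∪ {0})| + min{a_k, r(k-1)+1} + Σ_{i=1}^{k-1} i·r_i - Σ_{i=1}^{m} i·r_i + m(Σ_{i=1}^{m} r_i - α) + k(r_k - r). -/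
open Pointwise

/-- Set of all nonempty subset sums of a finite set of integers. -/
def SetSub (A : Finset ℤ) : Finset ℤ :=
  (A.powerset.filter (fun B => B.Nonempty)).image fun B => B.sum id

/-- Set of all subset sums over subsets of cardinality at least `α`. -/
def SetSubAlpha (α : ℕ) (A : Finset ℤ) : Finset ℤ :=
  (A.powerset.filter (fun B => α ≤ B.card)).image fun B => B.sum id

/-- Set of all nonempty subsequence (sub-multiset) sums of a multiset of integers. -/
def SeqSub (A : Multiset ℤ) : Finset ℤ :=
  ((A.powerset.filter (fun B => B ≠ 0)).map Multiset.sum).toFinset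

/-- Set of all sub-multiset sums with at least `α` terms. -/
def SeqSubAlpha (α : ℕ) (A : Multiset ℤ) : Finset ℤ :=
  ((A.powerset.filter (fun B => α ≤ Multiset.card B)).map Multiset.sum).toFinset

/-- `h`-fold sumset of a finite set of integers. -/
def hfold : ℕ → Finset ℤ → Finset ℤ
  | 0, _ => {0}
  | n + 1, X => X + hfold n X

/-- Restricted 2-fold sumset: sums of two distinct elements. -/
def Res2 (A : Finset ℤ) : Finset ℤ :=
  ((A ×ˢ A).filter (fun p => p.1 ≠ p.2)).image fun p => p.1 + p.2

/-- The golden ratio. -/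
noncomputable def theta : ℝ := (1 + Real.sqrt 5) / 2

section Isoperimetric

open Finset Pointwise

variable {G : Type*} [AddCommGroup G] [Fintype G] [DecidableEq G]

/-- The isoperimetric inequality for sumsets in a finite abelian group: the least value of
`|T + C| - |T|` over the nonempty `T` with `T + C ≠ G` is attained by a subgroup. -/
theorem exists_addSubgroup_card_add_le (C : Finset G) (hCu : C ≠ univ) :
    ∃ (H : AddSubgroup G) (K : Finset G), (∀ x, x ∈ K ↔ x ∈ H) ∧ K + C ≠ univ ∧
      ∀ T : Finset G, T.Nonempty → T + C ≠ univ →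
        T.card + (K + C).card ≤ (T + C).card + K.card := by
  classical
  set V : Finset (Finset G) := univ.filter fun X => X.Nonempty ∧ X + C ≠ univ with hV
  have hVne : V.Nonempty := ⟨{0}, mem_filter.2
    ⟨mem_univ _, singleton_nonempty 0, by rwa [singleton_zero, zero_add]⟩⟩
  set f : Finset G → ℤ := fun X => ((X + C).card : ℤ) - X.card with hf
  obtain ⟨X₁, hX₁, hmin₁⟩ := exists_min_image V f hVne
  obtain ⟨X, hX, hminX⟩ := exists_min_image (V.filter fun Y => f Y = f X₁) card
    ⟨X₁, by simp [hX₁]⟩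
  rw [mem_filter] at hX
  obtain ⟨hXV, hfX⟩ := hX
  have hmin : ∀ Y : Finset G, Y.Nonempty → Y + C ≠ univ → f X ≤ f Y := fun Y h1 h2 => by
    rw [hfX]; exact hmin₁ Y (by simp [hV, h1, h2])
  have hcard : ∀ Y : Finset G, Y.Nonempty → Y + C ≠ univ → f Y ≤ f X → X.card ≤ Y.card :=
    fun Y h1 h2 h3 => hminX Y (mem_filter.2 ⟨by simp [hV, h1, h2],
      (h3.trans hfX.le).antisymm (hfX.symm.le.trans (hmin Y h1 h2))⟩)
  obtain ⟨hXne, hXu⟩ : X.Nonempty ∧ X + C ≠ univ := by simpa [hV] using hXV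
  have key : ∀ g : G, (X ∩ (g +ᵥ X)).Nonempty → g +ᵥ X = X := by
    intro g hg
    set Y := g +ᵥ X with hY
    have hYc : Y.card = X.card := by simp [hY]
    have hYC : Y + C = g +ᵥ (X + C) := by rw [hY, vadd_add_assoc]
    have hYCc : (Y + C).card = (X + C).card := by rw [hYC, card_vadd_finset]
    have hYne : Y.Nonempty := by simpa [hY] using hXne
    have hIu : (X ∩ Y) + C ≠ univ := fun h =>
      hXu (eq_univ_iff_forall.2 fun x => add_subset_add_right inter_subset_left (h ▸ mem_univ x))
    have hsub : (X ∩ Y) + C ⊆ (X + C) ∩ (Y + C) := inter_add_subset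
    have hI := card_le_card hsub
    have hu := card_union_add_card_inter (X + C) (Y + C)
    rw [← union_add] at hu
    have hu' := card_union_add_card_inter X Y
    have h1 := hmin _ hg hIu
    by_cases hU : (X ∪ Y) + C = univ
    · exfalso
      set Z : Finset G := -(univ \ (Y + C)) with hZ
      have hZC : Z + C ⊆ -(univ \ Y) := by
        intro w hw
        obtain ⟨z, hz, c, hc, rfl⟩ := mem_add.1 hw
        simp only [hZ, mem_neg', mem_sdiff, mem_univ, true_and] at hz ⊢
        intro h
        exact hz (by simpa using add_mem_add h hc)
      have hZCc := card_le_card hZC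
      have hY1 := card_le_univ Y
      have hYC1 : (Y + C).card < Fintype.card G := by
        rw [hYCc]; exact (card_lt_iff_ne_univ _).2 hXu
      have hZc : Z.card = Fintype.card G - (Y + C).card := by
        rw [hZ, card_neg, card_sdiff_of_subset (subset_univ _), card_univ]
      rw [card_neg, card_sdiff_of_subset (subset_univ _), card_univ] at hZCc
      have hYpos := hYne.card_pos
      have hZu : Z + C ≠ univ := by
        intro h
        rw [h, card_univ] at hZCc
        omega
      have h2 := hcard Z (card_pos.1 (by omega)) hZu (by simp only [hf]; omega)
      rw [hU, card_univ] at hu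
      have := hg.card_pos
      simp only [hf] at h1
      omega
    · have h2 := hmin _ (hXne.mono subset_union_left) hU
      have h3 := hcard _ hg hIu (by simp only [hf] at h1 h2 ⊢; omega)
      have h4 : X ∩ Y = X := eq_of_subset_of_card_le inter_subset_left h3
      exact (eq_of_subset_of_card_le (inter_eq_left.1 h4) hYc.le).symm
  obtain ⟨x₀, hx₀⟩ := hXne
  have hK : ∀ x, x ∈ univ.filter (· ∈ AddAction.stabilizer G X) ↔ x ∈ AddAction.stabilizer G X := by
    simp
  have hXK : X = x₀ +ᵥ univ.filter (· ∈ AddAction.stabilizer G X) := by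
    ext x
    rw [mem_vadd_finset]
    constructor
    · intro hx
      refine ⟨x - x₀, (hK _).2 (AddAction.mem_stabilizer_iff.2 (key _ ⟨x, ?_⟩)), by simp⟩
      exact mem_inter.2 ⟨hx, mem_vadd_finset.2 ⟨x₀, hx₀, by simp⟩⟩
    · rintro ⟨y, hy, rfl⟩
      have h1 := AddAction.mem_stabilizer_iff.1 ((hK _).1 hy)
      rw [← h1, mem_vadd_finset]
      exact ⟨x₀, hx₀, by simp [add_comm]⟩
  have hc1 : X.card = (univ.filter (· ∈ AddAction.stabilizer G X)).card := by
    conv_lhs => rw [hXK, card_vadd_finset]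
  have hc2 : X + C = x₀ +ᵥ (univ.filter (· ∈ AddAction.stabilizer G X) + C) := by
    conv_lhs => rw [hXK, vadd_add_assoc]
  have hc3 : (X + C).card = (univ.filter (· ∈ AddAction.stabilizer G X) + C).card := by
    rw [hc2, card_vadd_finset]
  refine ⟨AddAction.stabilizer G X, _, hK, fun h => hXu ?_, fun T hT hTu => ?_⟩
  · rw [← card_eq_iff_eq_univ, hc3, h, card_univ]
  · have := hmin T hT hTu
    simp only [hf] at this
    omega

end Isoperimetric

section Lev

open Finset Pointwise

theorem subset_hfold_succ {B : Finset ℤ} (h0 : 0 ∈ B) (j : ℕ) : hfold j B ⊆ hfold (j + 1) B :=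
  subset_add_right _ h0

theorem hfold_nonempty {B : Finset ℤ} (hB : B.Nonempty) (j : ℕ) : (hfold j B).Nonempty := by
  induction j with
  | zero => exact singleton_nonempty 0
  | succ j ih => exact hB.add ih

variable {G : Type*} [AddCommGroup G] [DecidableEq G]

theorem image_hfold_succ (φ : ℤ →+ G) (B : Finset ℤ) (j : ℕ) :
    (hfold (j + 1) B).image φ = B.image φ + (hfold j B).image φ :=
  image_add φ

/-- Comparing `hfold j B` with its translate by `l` inside `hfold (j + 1) B`, class by class
modulo the kernel of `φ`. -/
theorem card_hfold_add_card_image_le (φ : ℤ →+ G) {B : Finset ℤ} {l : ℤ} (hl : 0 < l)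
    (hφ : φ l = 0) (h0 : 0 ∈ B) (hlB : l ∈ B) (j : ℕ) (U : Finset G)
    (hU : ∀ x ∈ hfold j B, φ x ∉ U) :
    (hfold j B).card + ((hfold (j + 1) B).image φ \ U).card
      + ((hfold (j + 1) B).filter (fun x => φ x ∈ U)).card ≤ (hfold (j + 1) B).card := by
  set E := (hfold (j + 1) B).filter fun x => x - l ∉ hfold j B with hE
  have h1 : (hfold j B).card ≤ ((hfold (j + 1) B).filter fun x => x - l ∈ hfold j B).card := by
    refine card_le_card_of_injOn (fun x => l + x) (fun x hx => ?_) (fun x _ y _ h => by simpa using h)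
    have hx' : x ∈ hfold j B := hx
    exact mem_filter.2 ⟨add_mem_add hlB hx', by simpa using hx'⟩
  have h2 := card_filter_add_card_filter_not (s := hfold (j + 1) B) fun x => x - l ∈ hfold j B
  change _ + E.card = _ at h2
  have h3 := card_filter_add_card_filter_not (s := E) fun x => φ x ∈ U
  have h4 : ((hfold (j + 1) B).filter (fun x => φ x ∈ U)).card
      ≤ (E.filter fun x => φ x ∈ U).card := by
    refine card_le_card fun x hx => ?_
    rw [mem_filter] at hx
    refine mem_filter.2 ⟨mem_filter.2 ⟨hx.1, fun h => hU _ h ?_⟩, hx.2⟩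
    rw [map_sub, hφ, sub_zero]
    exact hx.2
  have h5 : ((hfold (j + 1) B).image φ \ U).card ≤ (E.filter fun x => φ x ∉ U).card := by
    refine (card_le_card fun c hc => ?_).trans (card_image_le (f := φ))
    obtain ⟨hc1, hc2⟩ := mem_sdiff.1 hc
    obtain ⟨x₀, hx₀, hx₀c⟩ := mem_image.1 hc1
    obtain ⟨x, hx, hmin⟩ := exists_min_image ((hfold (j + 1) B).filter fun x => φ x = c) id
      ⟨x₀, by simp [hx₀, hx₀c]⟩
    obtain ⟨hx1, hx2⟩ := mem_filter.1 hx
    refine mem_image.2 ⟨x, mem_filter.2 ⟨mem_filter.2 ⟨hx1, fun h => ?_⟩, hx2 ▸ hc2⟩, hx2⟩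
    have := hmin (x - l) (mem_filter.2 ⟨subset_hfold_succ h0 j h, by rw [map_sub, hφ, hx2, sub_zero]⟩)
    simp only [id] at this
    omega
  omega

/-- The number of elements of the coset of `x` that are missing from `C`. -/
def holes (K C : Finset G) (x : G) : ℕ := (K.filter fun t => x + t ∉ C).card

variable {H : AddSubgroup G} {K C : Finset G}

theorem card_filter_mem_add_holes (K C : Finset G) (x : G) :
    (K.filter fun t => x + t ∈ C).card + holes K C x = K.card :=
  card_filter_add_card_filter_not _

theorem holes_le_card_sdiff {x : G} (hx : x ∈ C) : holes K C x ≤ ((K + C) \ C).card := by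
  refine card_le_card_of_injOn (fun t => x + t) (fun t ht => ?_) (fun s _ t _ h => by simpa using h)
  obtain ⟨h1, h2⟩ := mem_filter.1 ht
  exact mem_sdiff.2 ⟨mem_add.2 ⟨t, h1, x, hx, add_comm t x⟩, h2⟩

theorem holes_add_holes_le (hK : ∀ x, x ∈ K ↔ x ∈ H) {x y : G} (hx : x ∈ C) (hy : y ∈ C)
    (hxy : x - y ∉ H) :
    holes K C x + holes K C y ≤ ((K + C) \ C).card := by
  have hinj : ∀ z : G, Function.Injective fun t => z + t := fun z s t h => by simpa using h
  have hx' := card_image_of_injective (K.filter fun t => x + t ∉ C) (hinj x)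
  have hy' := card_image_of_injective (K.filter fun t => y + t ∉ C) (hinj y)
  rw [holes, holes, ← hx', ← hy', ← card_union_of_disjoint]
  · refine card_le_card (union_subset ?_ ?_) <;>
    · intro z hz
      obtain ⟨t, ht, rfl⟩ := mem_image.1 hz
      obtain ⟨h1, h2⟩ := mem_filter.1 ht
      refine mem_sdiff.2 ⟨?_, h2⟩
      exact mem_add.2 ⟨t, h1, _, by assumption, add_comm _ _⟩
  · rw [disjoint_left]
    intro z hz hz'
    obtain ⟨t, ht, rfl⟩ := mem_image.1 hz
    obtain ⟨s, hs, hst⟩ := mem_image.1 hz'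
    refine hxy ?_
    have hst' : y + s = x + t := hst
    have : x - y = s - t := by rw [sub_eq_sub_iff_add_eq_add, add_comm s, ← hst']
    rw [this]
    exact H.sub_mem ((hK s).1 (mem_filter.1 hs).1) ((hK t).1 (mem_filter.1 ht).1)

theorem add_add_mem_of_holes_lt (hK : ∀ x, x ∈ K ↔ x ∈ H) {x y t : G} (ht : t ∈ H)
    (h : holes K C x + holes K C y < K.card) : x + y + t ∈ C + C := by
  by_contra hcon
  have h1 : K ⊆ (K.filter fun s => x + s ∉ C) ∪ (K.filter fun s => y + (t - s) ∉ C) := by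
    intro s hs
    by_contra hs'
    simp only [mem_union, mem_filter, not_or, not_and, not_not] at hs'
    refine hcon ?_
    have := add_mem_add (hs'.1 hs) (hs'.2 hs)
    rwa [show x + s + (y + (t - s)) = x + y + t by abel] at this
  have h2 : (K.filter fun s => y + (t - s) ∉ C).card ≤ holes K C y := by
    refine card_le_card_of_injOn (fun s => t - s) (fun s hs => ?_)
      (fun s _ u _ h => by simpa using h)
    obtain ⟨h1, h2⟩ := mem_filter.1 hs
    exact mem_filter.2 ⟨(hK _).2 (H.sub_mem ht ((hK s).1 h1)), h2⟩
  have := (card_le_card h1).trans (card_union_le _ _)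
  rw [holes] at h
  omega

/-- The integers of `hfold j B` lying over the coset of a given element of the image. -/
theorem exists_card_filter_hfold_ge [DecidablePred (· ∈ H)] (φ : ℤ →+ G) {B : Finset ℤ}
    (hK : ∀ x, x ∈ K ↔ x ∈ H) {f₀ : G} (hf₀ : f₀ ∈ B.image φ) (j : ℕ) :
    ∀ e ∈ (hfold j B).image φ, ∃ s : ℕ, s ≤ j * ((K + B.image φ) \ B.image φ).card ∧
      (e - j • f₀ ∉ H →
        s + holes K (B.image φ) f₀ ≤ j * ((K + B.image φ) \ B.image φ).card) ∧
      j * K.card + 1 ≤ ((hfold j B).filter fun x => φ x - e ∈ H).card + s + j := by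
  set g := ((K + B.image φ) \ B.image φ).card
  induction j with
  | zero =>
    intro e he
    have he' : e = 0 := by simpa [hfold] using he
    subst he'
    exact ⟨0, by simp, by simp [H.zero_mem], by simp [hfold, H.zero_mem, filter_singleton]⟩
  | succ j ih =>
    intro e he
    rw [image_hfold_succ] at he
    obtain ⟨x, hx, e', he', rfl⟩ := mem_add.1 he
    obtain ⟨s, hs1, hs2, hs3⟩ := ih e' he'
    have hgx : holes K (B.image φ) x ≤ g := holes_le_card_sdiff hx
    refine ⟨s + holes K (B.image φ) x, by rw [add_one_mul]; omega, fun hne => ?_, ?_⟩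
    · rw [add_one_mul]
      by_cases hxf : x - f₀ ∈ H
      · have : e' - j • f₀ ∉ H := fun h => hne (by
          have := H.add_mem hxf h
          rwa [show x - f₀ + (e' - j • f₀) = x + e' - (j + 1) • f₀ by
            rw [add_smul, one_smul]; abel] at this)
        have := hs2 this
        omega
      · have : _ ≤ g := holes_add_holes_le hK hx hf₀ hxf
        omega
    · set F₁ := B.filter fun y => φ y - x ∈ H with hF₁
      set F₂ := (hfold j B).filter fun y => φ y - e' ∈ H with hF₂
      have hF₁c : (K.filter fun t => x + t ∈ B.image φ).card ≤ F₁.card := by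
        rw [← card_image_of_injective _ (add_right_injective x)]
        refine (card_le_card fun z hz => ?_).trans (card_image_le (f := φ))
        obtain ⟨t, ht, rfl⟩ := mem_image.1 hz
        obtain ⟨h1, h2⟩ := mem_filter.1 ht
        obtain ⟨b, hb, hbt⟩ := mem_image.1 h2
        exact mem_image.2 ⟨b, mem_filter.2 ⟨hb, by simpa [hbt] using (hK t).1 h1⟩, hbt⟩
      have hF₁n : F₁.Nonempty := by
        obtain ⟨b, hb, rfl⟩ := mem_image.1 hx
        exact ⟨b, mem_filter.2 ⟨hb, by simp [H.zero_mem]⟩⟩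
      have hF₂n : F₂.Nonempty := by
        obtain ⟨b, hb, rfl⟩ := mem_image.1 he'
        exact ⟨b, mem_filter.2 ⟨hb, by simp [H.zero_mem]⟩⟩
      have hsub : F₁ + F₂ ⊆ (hfold (j + 1) B).filter fun y => φ y - (x + e') ∈ H := by
        intro z hz
        obtain ⟨y₁, h₁, y₂, h₂, rfl⟩ := mem_add.1 hz
        rw [mem_filter] at h₁ h₂
        refine mem_filter.2 ⟨add_mem_add h₁.1 h₂.1, ?_⟩
        have := H.add_mem h₁.2 h₂.2
        rwa [show φ y₁ - x + (φ y₂ - e') = φ (y₁ + y₂) - (x + e') by rw [map_add]; abel] at this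
      have h1 := card_le_card hsub
      have h2 := cauchy_davenport_add_of_linearOrder_isCancelAdd hF₁n hF₂n
      have h3 := card_filter_mem_add_holes K (B.image φ) x
      rw [add_one_mul]
      omega

theorem sub_nsmul_mem_or_exists_add (φ : ℤ →+ G) {B : Finset ℤ} (f₀ : G) (i : ℕ) :
    ∀ p ∈ (hfold (i + 1) B).image φ, p - (i + 1) • f₀ ∈ H ∨
      ∃ x ∈ B.image φ, x - f₀ ∉ H ∧ ∃ s ∈ (hfold i B).image φ, p = x + s := by
  induction i with
  | zero =>
    intro p hp
    rw [image_hfold_succ] at hp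
    obtain ⟨x, hx, s, hs, rfl⟩ := mem_add.1 hp
    have hs' : s = 0 := by simpa [hfold] using hs
    by_cases h : x - f₀ ∈ H
    · left; simpa [hs'] using h
    · exact Or.inr ⟨x, hx, h, s, hs, rfl⟩
  | succ i ih =>
    intro p hp
    rw [image_hfold_succ] at hp
    obtain ⟨x, hx, s, hs, rfl⟩ := mem_add.1 hp
    by_cases h : x - f₀ ∈ H
    · rcases ih s hs with h' | ⟨x', hx', hne, s', hs', rfl⟩
      · left
        have := H.add_mem h h'
        rwa [show x - f₀ + (s - (i + 1) • f₀) = x + s - (i + 1 + 1) • f₀ by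
          rw [add_smul (i + 1) 1, one_smul]; abel] at this
      · refine Or.inr ⟨x', hx', hne, x + s', ?_, by abel⟩
        rw [image_hfold_succ]
        exact add_mem_add hx hs'
    · exact Or.inr ⟨x, hx, h, s, hs, rfl⟩

theorem nsmul_mem_image_hfold (φ : ℤ →+ G) {B : Finset ℤ} {f₀ : G} (hf₀ : f₀ ∈ B.image φ) (i : ℕ) :
    i • f₀ ∈ (hfold i B).image φ := by
  induction i with
  | zero => simp [hfold]
  | succ i ih =>
    rw [image_hfold_succ, succ_nsmul']
    exact add_mem_add hf₀ ih

set_option maxHeartbeats 400000 in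
/-- A growth bound for iterated sumsets: the first difference of `j ↦ |hfold j B|` is bounded below
in terms of a group in which the generator `l` of the extremal direction vanishes. -/
theorem card_hfold_add_min_card_le [Fintype G] (φ : ℤ →+ G) {B : Finset ℤ} {l : ℤ} (hl : 0 < l)
    (hφ : φ l = 0) (h0 : 0 ∈ B) (hlB : l ∈ B)
    (hgen : ∀ H : AddSubgroup G, (∀ b ∈ B, φ b ∈ H) → H = ⊤) (j : ℕ) :
    (hfold (j + 1) B).card + min (Fintype.card G) ((j + 2) * ((B.image φ).card - 1) + 1)
      ≤ (hfold (j + 2) B).card := by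
  classical
  set C := B.image φ with hC
  set P : ℕ → Finset G := fun i => (hfold i B).image φ with hP
  have hPs : ∀ i, P (i + 1) = C + P i := image_hfold_succ φ B
  have hPne : ∀ i, (P i).Nonempty := fun i => (hfold_nonempty ⟨0, h0⟩ i).image φ
  have h0C : (0 : G) ∈ C := mem_image.2 ⟨0, h0, map_zero φ⟩
  have hCpos : 0 < C.card := card_pos.2 ⟨0, h0C⟩
  have hcount := card_hfold_add_card_image_le φ hl hφ h0 hlB (j + 1)
  change ∀ U : Finset G, _ → _ + (P (j + 2) \ U).card + _ ≤ (hfold (j + 2) B).card at hcount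
  have hcount0 : (hfold (j + 1) B).card + (P (j + 2)).card ≤ (hfold (j + 2) B).card := by
    simpa using hcount ∅ (by simp)
  have hfull : P (j + 2) = univ → (hfold (j + 1) B).card
      + min (Fintype.card G) ((j + 2) * (C.card - 1) + 1) ≤ (hfold (j + 2) B).card := by
    intro h
    rw [h, card_univ] at hcount0
    exact (Nat.add_le_add_left (min_le_left _ _) _).trans hcount0
  by_cases hCu : C = univ
  · refine hfull ((card_eq_iff_eq_univ _).1 (le_antisymm (card_le_univ _) ?_))
    rw [hPs, ← card_univ, ← hCu]
    exact card_le_card_add_right (hPne _)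
  obtain ⟨H, K, hK, hKu, hiso⟩ := exists_addSubgroup_card_add_le C hCu
  have h0K : (0 : G) ∈ K := (hK 0).2 H.zero_mem
  have hKne : K.Nonempty := ⟨0, h0K⟩
  have hKC : K ⊆ K + C := subset_add_left _ h0C
  have hCK : C ⊆ K + C := subset_add_right _ h0K
  obtain ⟨κ, hκ⟩ := Nat.exists_eq_add_of_le (card_le_card hKC)
  have hgrow : ∀ T : Finset G, T.Nonempty → T + C ≠ univ → T.card + κ ≤ (T + C).card := by
    intro T hT hTu
    have := hiso T hT hTu
    omega
  have hκpos : 0 < κ := by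
    by_contra hκ0
    have h1 : K = K + C := eq_of_subset_of_card_le hKC (by omega)
    have h2 : H = ⊤ := hgen H fun b hb => (hK _).1 (h1 ▸ hCK (mem_image_of_mem φ hb))
    refine hKu (h1 ▸ eq_univ_iff_forall.2 fun x => (hK x).2 ?_)
    rw [h2]
    trivial
  have hgrowP : ∀ L : Finset G, L.Nonempty → ∀ i, L + P i = univ ∨ L.card + i * κ ≤ (L + P i).card := by
    intro L hL i
    induction i with
    | zero => right; simp [hP, hfold]
    | succ i ih =>
      have hstep : L + P (i + 1) = L + P i + C := by rw [hPs, add_comm C, add_assoc]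
      rw [hstep]
      by_cases hu : L + P i + C = univ
      · exact Or.inl hu
      · right
        rcases ih with h | h
        · refine absurd ((card_eq_iff_eq_univ _).1 (le_antisymm (card_le_univ _) ?_)) hu
          rw [← card_univ, ← h]
          exact card_le_card_add_right ⟨0, h0C⟩
        · have := hgrow _ (hL.add (hPne i)) hu
          rw [add_one_mul]
          omega
  by_cases hsparse : C.card - 1 ≤ κ
  · rcases hgrowP {0} (singleton_nonempty 0) (j + 2) with h | h
    · rw [singleton_zero, zero_add] at h
      exact hfull h
    · rw [singleton_zero, zero_add, card_zero] at h
      have := Nat.mul_le_mul_left (j + 2) hsparse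
      have := min_le_right (Fintype.card G) ((j + 2) * (C.card - 1) + 1)
      omega
  set g := ((K + C) \ C).card with hg
  have hgC : g + C.card = K.card + κ := by rw [hg, card_sdiff_add_card_eq_card hCK, hκ]
  obtain ⟨f₀, hf₀, hmax⟩ := exists_max_image C (holes K C) ⟨0, h0C⟩
  have hsmall : ∀ x ∈ C, ∀ y ∈ C, x - f₀ ∉ H → holes K C x + holes K C y < K.card := by
    intro x hx y hy hxf
    have h1 : _ ≤ g := holes_add_holes_le hK hx hf₀ hxf
    by_cases hxy : x - y ∈ H
    · have hyf : y - f₀ ∉ H := fun h => hxf (by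
        have := H.add_mem hxy h
        rwa [sub_add_sub_cancel] at this)
      have h2 : _ ≤ g := holes_add_holes_le hK hy hf₀ hyf
      have := hmax x hx
      omega
    · have : _ ≤ g := holes_add_holes_le hK hx hy hxy
      omega
  have hfill : ∀ x ∈ C, x - f₀ ∉ H → ∀ s ∈ P (j + 1), ∀ t ∈ H, x + s + t ∈ P (j + 2) := by
    intro x hx hxf s hs t ht
    rw [hPs] at hs
    obtain ⟨y, hy, s', hs', rfl⟩ := mem_add.1 hs
    have := add_mem_add (add_add_mem_of_holes_lt hK ht (hsmall x hx y hy hxf)) hs'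
    rw [hPs, hPs, ← add_assoc]
    rwa [show x + y + t + s' = x + (y + s') + t by abel] at this
  have hcoset : ∀ e : G, (univ.filter fun z => z - e ∈ H).card ≤ K.card := fun e =>
    card_le_card_of_injOn (fun z => z - e) (fun z hz => (hK _).2 (mem_filter.1 hz).2)
      (fun x _ y _ h => by simpa using h)
  by_cases hpig : Fintype.card G < κ + (K + P (j + 1)).card
  · refine hfull (eq_univ_iff_forall.2 fun z => ?_)
    set N := (K + C).filter fun w => w - f₀ ∉ H with hN
    have hNc : κ ≤ N.card := by
      have h1 := card_filter_add_card_filter_not (s := K + C) fun w => w - f₀ ∈ H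
      change _ + N.card = _ at h1
      have h2 := (card_le_card (filter_subset_filter (fun w => w - f₀ ∈ H)
        (subset_univ (K + C)))).trans (hcoset f₀)
      omega
    have hNi : (N.image fun w => z - w).card = N.card :=
      card_image_of_injective _ fun x y h => by simpa using h
    obtain ⟨w, hw⟩ : ((N.image fun w => z - w) ∩ (K + P (j + 1))).Nonempty := by
      have h1 := card_union_add_card_inter (N.image fun w => z - w) (K + P (j + 1))
      have h2 := card_le_univ ((N.image fun w => z - w) ∪ (K + P (j + 1)))
      exact card_pos.1 (by omega)
    obtain ⟨hw1, hw2⟩ := mem_inter.1 hw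
    obtain ⟨n, hn, rfl⟩ := mem_image.1 hw1
    obtain ⟨t, ht, s, hs, hts⟩ := mem_add.1 hw2
    obtain ⟨hn1, hn2⟩ := mem_filter.1 hn
    obtain ⟨t', ht', x, hx, rfl⟩ := mem_add.1 hn1
    have hxf : x - f₀ ∉ H := fun h => hn2 (by
      have := H.add_mem ((hK _).1 ht') h
      rwa [← add_sub_assoc] at this)
    have := hfill x hx hxf s hs (t + t') (H.add_mem ((hK _).1 ht) ((hK _).1 ht'))
    rwa [show x + s + (t + t') = z by
      rw [show x + s + (t + t') = (t + s) + (t' + x) by abel, hts, sub_add_cancel]] at this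
  · have hQ1 : K + P (j + 1) ≠ univ := fun h => by
      rw [h, card_univ] at hpig
      omega
    have hQ1c := (hgrowP K hKne (j + 1)).resolve_left hQ1
    have hQ2c : K.card + (j + 2) * κ ≤ (K + P (j + 2)).card := by
      rcases hgrowP K hKne (j + 2) with h | h
      · rw [h, card_univ]
        have : (j + 2) * κ = (j + 1) * κ + κ := by ring
        omega
      · exact h
    obtain ⟨e, he, heQ⟩ : ∃ e ∈ P (j + 2), e ∉ K + P (j + 1) := by
      by_contra! hcon
      have hsub : K + P (j + 2) ⊆ K + P (j + 1) := by
        intro w hw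
        obtain ⟨t, ht, p, hp, rfl⟩ := mem_add.1 hw
        obtain ⟨t', ht', p', hp', rfl⟩ := mem_add.1 (hcon p hp)
        rw [← add_assoc]
        exact add_mem_add ((hK _).2 (H.add_mem ((hK _).1 ht) ((hK _).1 ht'))) hp'
      have hstep : K + P (j + 2) = K + P (j + 1) + C := by rw [hPs, add_comm C, add_assoc]
      have hne : K + P (j + 1) + C ≠ univ := fun h =>
        hQ1 (eq_univ_iff_forall.2 fun x => hsub (by rw [hstep, h]; exact mem_univ x))
      have h1 := hgrow _ (hKne.add (hPne _)) hne
      have h2 := card_le_card hsub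
      rw [hstep] at h2
      omega
    set U := univ.filter fun z => z - e ∈ H with hU
    have hUc : U.card ≤ K.card := hcoset e
    have hUd : ∀ x ∈ hfold (j + 1) B, φ x ∉ U := fun x hx hxU => heQ (by
      have hxe : φ x - e ∈ H := by simpa [hU] using hxU
      refine mem_add.2 ⟨e - φ x, (hK _).2 ?_, φ x, mem_image_of_mem φ hx, sub_add_cancel _ _⟩
      rw [← neg_sub]
      exact H.neg_mem hxe)
    obtain ⟨s, hs1, hs2, hs3⟩ := exists_card_filter_hfold_ge φ hK hf₀ (j + 2) e he
    have hc := hcount U hUd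
    have hfU : ((hfold (j + 1 + 1) B).filter fun x => φ x ∈ U)
        = (hfold (j + 2) B).filter fun x => φ x - e ∈ H := by
      simp [hU]
    rw [hfU] at hc
    change s ≤ (j + 2) * g at hs1
    change _ → s + holes K C f₀ ≤ (j + 2) * g at hs2
    set M := (K + P (j + 2)) \ P (j + 2) with hM
    have hMmem : ∀ z ∈ M, z - (j + 2) • f₀ ∈ H := by
      intro z hz
      obtain ⟨hz1, hz2⟩ := mem_sdiff.1 hz
      obtain ⟨t, ht, p, hp, rfl⟩ := mem_add.1 hz1
      rcases sub_nsmul_mem_or_exists_add (H := H) φ f₀ (j + 1) p hp with h | ⟨x, hx, hxf, s, hs, rfl⟩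
      · rw [add_sub_assoc]
        exact H.add_mem ((hK _).1 ht) h
      · refine absurd ?_ hz2
        rw [add_comm t]
        exact hfill x hx hxf s hs t ((hK _).1 ht)
    have hMc : M.card ≤ holes K C f₀ := by
      refine card_le_card_of_injOn (fun z => z - (j + 2) • f₀) (fun z hz => ?_)
        (fun x _ y _ h => by simpa using h)
      refine mem_filter.2 ⟨(hK _).2 (hMmem z hz), fun h => (mem_sdiff.1 hz).2 ?_⟩
      have := add_mem_add h (nsmul_mem_image_hfold φ hf₀ (j + 1))
      rw [hPs]
      rwa [show f₀ + (z - (j + 2) • f₀) + (j + 1) • f₀ = z by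
        rw [show j + 2 = j + 1 + 1 from rfl, add_smul (j + 1) 1, one_smul]; abel] at this
    have hMU : (M \ U).card + s ≤ (j + 2) * g := by
      by_cases hef : e - (j + 2) • f₀ ∈ H
      · have : M \ U = ∅ := sdiff_eq_empty_iff_subset.2 fun z hz => by
          have := H.sub_mem (hMmem z hz) hef
          rw [sub_sub_sub_cancel_right] at this
          simpa [hU] using this
        rw [this, card_empty]
        omega
      · have h1 := hs2 hef
        have h2 := card_le_card (sdiff_subset (s := M) (t := U))
        omega
    have hQU : (K + P (j + 2)).card ≤ (P (j + 2) \ U).card + (M \ U).card + U.card := by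
      refine (card_le_card fun z hz => ?_).trans
        ((card_union_le _ _).trans (Nat.add_le_add_right (card_union_le _ _) _))
      simp only [hM, mem_union, mem_sdiff]
      by_cases h1 : z ∈ U <;> by_cases h2 : z ∈ P (j + 2) <;> simp [hz, h1, h2]
    have h1 : (j + 2) * (C.card - 1) + (j + 2) * g + (j + 2) = (j + 2) * K.card + (j + 2) * κ := by
      rw [← mul_add, ← mul_add, ← hgC, ← mul_add_one]
      congr 1
      omega
    have := min_le_right (Fintype.card G) ((j + 2) * (C.card - 1) + 1)
    omega

end Lev

section Growth

open Finset

/-- The lower bound of Lev for the growth of the iterated sumsets of a normalised set of integers. -/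
theorem card_hfold_add_min_le {k : ℕ} (hk : 1 ≤ k) {a : ℕ → ℤ}
    (ha : ∀ i j, 1 ≤ i → i < j → j ≤ k → a i < a j) (hpos : ∀ i, 1 ≤ i → i ≤ k → 0 < a i)
    (hgcd : (Icc 1 k).gcd a = 1) (j : ℕ) :
    ((hfold (j + 1) (insert 0 ((Icc 1 k).image a))).card : ℤ)
      + min (a k) (((j + 2 : ℕ) : ℤ) * ((k : ℤ) - 1) + 1)
      ≤ (hfold (j + 2) (insert 0 ((Icc 1 k).image a))).card := by
  set B := insert 0 ((Icc 1 k).image a) with hB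
  have hl : 0 < a k := hpos k hk le_rfl
  have hL : ((a k).toNat : ℤ) = a k := Int.toNat_of_nonneg hl.le
  have : NeZero (a k).toNat := ⟨by omega⟩
  set φ : ℤ →+ ZMod (a k).toNat := Int.castAddHom _ with hφ
  have haB : ∀ i ∈ Icc 1 k, a i ∈ B := fun i hi => mem_insert_of_mem (mem_image_of_mem a hi)
  have h0 : (0 : ℤ) ∈ B := mem_insert_self _ _
  have hlB : a k ∈ B := haB k (by simp [hk])
  have hφl : φ (a k) = 0 := by
    rw [hφ, Int.coe_castAddHom, ZMod.intCast_zmod_eq_zero_iff_dvd, hL]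
  have hgen : ∀ H : AddSubgroup (ZMod (a k).toNat), (∀ b ∈ B, φ b ∈ H) → H = ⊤ := by
    intro H hH
    obtain ⟨g, hg⟩ := Int.subgroup_cyclic (H.comap φ)
    rw [← AddSubgroup.zmultiples_eq_closure] at hg
    have hdvd : g ∣ (Icc 1 k).gcd a := dvd_gcd fun i hi => by
      have : a i ∈ H.comap φ := hH _ (haB i hi)
      rwa [hg, Int.mem_zmultiples_iff] at this
    rw [hgcd] at hdvd
    refine (AddSubgroup.eq_top_iff' H).2 fun z => ?_
    obtain ⟨x, rfl⟩ := ZMod.intCast_surjective z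
    have : x ∈ H.comap φ := by
      rw [hg, Int.mem_zmultiples_iff]
      exact hdvd.trans (one_dvd x)
    exact this
  have hinj : Set.InjOn a (Icc 1 k : Finset ℕ) := by
    intro i hi i' hi' h
    simp only [coe_Icc, Set.mem_Icc] at hi hi'
    rcases lt_trichotomy i i' with h1 | h1 | h1
    · exact absurd h (ha i i' hi.1 h1 hi'.2).ne
    · exact h1
    · exact absurd h (ha i' i hi'.1 h1 hi.2).ne'
  have hBc : B.card = k + 1 := by
    rw [hB, card_insert_of_notMem, card_image_of_injOn hinj, Nat.card_Icc, Nat.add_sub_cancel]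
    intro h
    obtain ⟨i, hi, h⟩ := mem_image.1 h
    rw [mem_Icc] at hi
    exact (hpos i hi.1 hi.2).ne' h
  have hrange : ∀ b ∈ B.erase (a k), 0 ≤ b ∧ b < a k := by
    intro b hb
    obtain ⟨hb1, hb2⟩ := mem_erase.1 hb
    rcases mem_insert.1 hb2 with rfl | hb2
    · exact ⟨le_rfl, hl⟩
    · obtain ⟨i, hi, rfl⟩ := mem_image.1 hb2
      rw [mem_Icc] at hi
      exact ⟨(hpos i hi.1 hi.2).le,
        ha i k hi.1 (lt_of_le_of_ne hi.2 fun h => hb1 (h ▸ rfl)) le_rfl⟩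
  have hC : k ≤ (B.image φ).card := by
    have h1 : (B.erase (a k)).card = k := by rw [card_erase_of_mem hlB, hBc, Nat.add_sub_cancel]
    refine h1.symm.le.trans (card_le_card_of_injOn φ (fun b hb => mem_image_of_mem φ (mem_of_mem_erase hb)) ?_)
    intro b hb b' hb' h
    have hb := hrange b hb
    have hb' := hrange b' hb'
    rw [hφ, Int.coe_castAddHom, ZMod.intCast_eq_intCast_iff, hL, Int.ModEq,
      Int.emod_eq_of_lt hb.1 hb.2, Int.emod_eq_of_lt hb'.1 hb'.2] at h
    exact h
  have hmain := card_hfold_add_min_card_le φ hl hφl h0 hlB hgen j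
  rw [ZMod.card] at hmain
  have hmul : (j + 2) * (k - 1) ≤ (j + 2) * ((B.image φ).card - 1) :=
    Nat.mul_le_mul_left _ (by omega)
  have hcast : ((j + 2 : ℕ) : ℤ) * ((k : ℤ) - 1) = (((j + 2) * (k - 1) : ℕ) : ℤ) := by
    rw [Nat.cast_mul, Nat.cast_sub hk, Nat.cast_one]
  rw [hcast]
  omega

end Growth

section Subsequence

open Finset

theorem sum_mul_mem_seqSubAlpha {k α : ℕ} (a : ℕ → ℤ) {r d : ℕ → ℕ}
    (hd : ∀ i ∈ Icc 1 k, d i ≤ r i) (hα : α ≤ ∑ i ∈ Icc 1 k, d i) :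
    ∑ i ∈ Icc 1 k, a i * (d i : ℤ) ∈
      SeqSubAlpha α (∑ i ∈ Icc 1 k, Multiset.replicate (r i) (a i)) := by
  simp only [SeqSubAlpha, Multiset.mem_toFinset, Multiset.mem_map, Multiset.mem_filter,
    Multiset.mem_powerset]
  refine ⟨∑ i ∈ Icc 1 k, Multiset.replicate (d i) (a i), ⟨?_, ?_⟩, ?_⟩
  · exact sum_le_sum fun i hi => (Multiset.replicate_le_replicate _).2 (hd i hi)
  · simpa [map_sum] using hα
  · rw [← Multiset.coe_sumAddMonoidHom, map_sum]
    exact sum_congr rfl fun i _ => by simp [mul_comm]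

/-- Moving one unit of the configuration `d` from `q` to `q - 1`, or removing it when `q = 1`. -/
theorem exists_shift {k α q : ℕ} {r d : ℕ → ℕ} (hd : ∀ i ∈ Icc 1 k, d i ≤ r i)
    (hα : α ≤ ∑ i ∈ Icc 1 k, d i) (hq : q ∈ Icc 1 k) (hdq : 0 < d q)
    (h1 : q = 1 → α < ∑ i ∈ Icc 1 k, d i) (h2 : 1 < q → d (q - 1) < r (q - 1)) :
    ∃ d' : ℕ → ℕ, (∀ i ∈ Icc 1 k, d' i ≤ r i) ∧ α ≤ ∑ i ∈ Icc 1 k, d' i ∧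
      ∀ f : ℕ → ℤ, ∑ i ∈ Icc 1 k, f i * (d' i : ℤ)
        = ∑ i ∈ Icc 1 k, f i * (d i : ℤ) + (if q = 1 then 0 else f (q - 1)) - f q := by
  rw [mem_Icc] at hq
  set d' : ℕ → ℕ := fun i => if i = q then d i - 1 else if i + 1 = q then d i + 1 else d i with hd'
  have hsum : ∀ f : ℕ → ℤ, ∑ i ∈ Icc 1 k, f i * (d' i : ℤ)
      = ∑ i ∈ Icc 1 k, f i * (d i : ℤ) + (if q = 1 then 0 else f (q - 1)) - f q := by
    intro f
    have hpt : ∀ i ∈ Icc 1 k, f i * (d' i : ℤ)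
        = f i * (d i : ℤ) + (if i = q - 1 then f i else 0) - (if i = q then f i else 0) := by
      intro i hi
      rw [mem_Icc] at hi
      rcases eq_or_ne i q with rfl | hiq
      · have hne : i ≠ i - 1 := by omega
        simp only [hd', if_true, if_neg hne]
        push_cast [Nat.cast_sub (Nat.succ_le_of_lt hdq)]
        ring
      · by_cases hiq' : i + 1 = q
        · have he : i = q - 1 := by omega
          simp only [hd', if_neg hiq, if_pos hiq', if_pos he]
          push_cast
          ring
        · have he : i ≠ q - 1 := by omega
          simp only [hd', if_neg hiq, if_neg hiq', if_neg he]
          ring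
    rw [sum_congr rfl hpt, sum_sub_distrib, sum_add_distrib, sum_ite_eq', sum_ite_eq',
      if_pos (mem_Icc.2 hq)]
    congr 2
    by_cases hq1 : q = 1
    · rw [if_pos hq1, if_neg]
      rw [mem_Icc]
      omega
    · rw [if_neg hq1, if_pos]
      rw [mem_Icc]
      omega
  refine ⟨d', fun i hi => ?_, ?_, hsum⟩
  · have hdi := hd i hi
    rw [mem_Icc] at hi
    simp only [hd']
    split_ifs with h3 h4
    · omega
    · subst h4
      have := h2 (by omega)
      rw [Nat.add_sub_cancel] at this
      omega
    · exact hdi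
  · have h := hsum fun _ => 1
    simp only [one_mul] at h
    rw [← Nat.cast_sum, ← Nat.cast_sum] at h
    by_cases hq1 : q = 1
    · have := h1 hq1
      rw [if_pos hq1] at h
      omega
    · rw [if_neg hq1] at h
      omega

/-- A configuration that is not of minimal weight can be lowered by one unit of weight. -/
theorem exists_lower {k m α : ℕ} {a : ℕ → ℤ} {r d : ℕ → ℕ}
    (ha : ∀ i j, 1 ≤ i → i < j → j ≤ k → a i < a j) (hpos : ∀ i, 1 ≤ i → i ≤ k → 0 < a i)
    (hr : ∀ i, 1 ≤ i → i ≤ k → 0 < r i) (hmk : m ≤ k)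
    (hm1 : ∑ i ∈ Icc 1 (m - 1), r i ≤ α) (hm2 : α < ∑ i ∈ Icc 1 m, r i)
    (hd : ∀ i ∈ Icc 1 k, d i ≤ r i) (hα : α ≤ ∑ i ∈ Icc 1 k, d i)
    (hW : ∑ i ∈ Icc 1 m, (i : ℤ) * (r i : ℤ) - (m : ℤ) * ((∑ i ∈ Icc 1 m, (r i : ℤ)) - α)
      < ∑ i ∈ Icc 1 k, (i : ℤ) * (d i : ℤ)) :
    ∃ d' : ℕ → ℕ, (∀ i ∈ Icc 1 k, d' i ≤ r i) ∧ α ≤ ∑ i ∈ Icc 1 k, d' i ∧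
      ∑ i ∈ Icc 1 k, (i : ℤ) * (d' i : ℤ) + 1 = ∑ i ∈ Icc 1 k, (i : ℤ) * (d i : ℤ) ∧
      ∑ i ∈ Icc 1 k, a i * (d' i : ℤ) < ∑ i ∈ Icc 1 k, a i * (d i : ℤ) := by
  by_cases hex : ∃ q ∈ Icc 1 k, 0 < d q ∧ (q = 1 → α < ∑ i ∈ Icc 1 k, d i) ∧
      (1 < q → d (q - 1) < r (q - 1))
  · obtain ⟨q, hq, hdq, h1, h2⟩ := hex
    obtain ⟨d', h3, h4, h5⟩ := exists_shift hd hα hq hdq h1 h2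
    rw [mem_Icc] at hq
    refine ⟨d', h3, h4, ?_, ?_⟩
    · rw [h5 fun i => (i : ℤ)]
      by_cases hq1 : q = 1
      · simp [hq1]
      · rw [if_neg hq1, Nat.cast_sub hq.1, Nat.cast_one]
        ring
    · rw [h5 a]
      by_cases hq1 : q = 1
      · have := hpos q hq.1 hq.2
        rw [if_pos hq1]
        omega
      · have := ha (q - 1) q (by omega) (by omega) hq.2
        rw [if_neg hq1]
        omega
  · exfalso
    push Not at hex
    have hstep : ∀ i, 1 ≤ i → i + 1 ≤ k → d i < r i → d (i + 1) = 0 := by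
      intro i hi hik hlt
      by_contra hne
      have := (hex (i + 1) (mem_Icc.2 ⟨by omega, hik⟩) (by omega) (fun h => by omega)).2
      rw [Nat.add_sub_cancel] at this
      omega
    have hdown : ∀ i, 1 ≤ i → d i < r i → ∀ j, i + 1 ≤ j → j ≤ k → d j = 0 := by
      intro i hi hlt j hij
      induction j, hij using Nat.le_induction with
      | base => exact fun h => hstep i hi h hlt
      | succ j hij ih =>
        intro hjk
        have h0 := ih (by omega)
        have := hr j (by omega) (by omega)
        exact hstep j (by omega) hjk (by omega)
    have hite : ∀ (n : ℕ) (f : ℕ → ℤ), n ≤ k →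
        ∑ i ∈ Icc 1 k, (if i ≤ n then f i else 0) = ∑ i ∈ Icc 1 n, f i := by
      intro n f hn
      rw [← sum_filter]
      refine sum_congr ?_ fun _ _ => rfl
      ext i
      simp only [mem_filter, mem_Icc]
      omega
    have hite' : ∀ n, n ≤ k → ∑ i ∈ Icc 1 k, (if i ≤ n then r i else 0) = ∑ i ∈ Icc 1 n, r i := by
      intro n hn
      have := hite n (fun i => (r i : ℤ)) hn
      exact_mod_cast this
    have hsum : ∑ i ∈ Icc 1 k, d i = α := by
      by_contra hne
      have hk : 1 ≤ k := by
        by_contra hk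
        have : k = 0 := by omega
        subst this
        simp at hα hne
        omega
      have hd1 : d 1 = 0 := by
        by_contra h
        exact absurd ((hex 1 (by simp [hk]) (by omega) fun _ => by omega).1) (by omega)
      have hr1 := hr 1 le_rfl hk
      have : ∑ i ∈ Icc 1 k, d i = 0 := sum_eq_zero fun i hi => by
        rw [mem_Icc] at hi
        rcases hi.1.eq_or_lt with rfl | h
        · exact hd1
        · exact hdown 1 le_rfl (by omega) i h hi.2
      omega
    have hlow : ∀ i, 1 ≤ i → i < m → d i = r i := by
      intro i hi him
      by_contra hne
      have hlt : d i < r i := lt_of_le_of_ne (hd i (mem_Icc.2 ⟨hi, by omega⟩)) hne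
      have : ∑ j ∈ Icc 1 k, d j < ∑ j ∈ Icc 1 k, (if j ≤ m - 1 then r j else 0) := by
        refine sum_lt_sum (fun j hj => ?_) ⟨i, mem_Icc.2 ⟨hi, by omega⟩, ?_⟩
        · have hdj := hd j hj
          rw [mem_Icc] at hj
          split_ifs with h
          · exact hdj
          · exact (hdown i hi hlt j (by omega) hj.2).le
        · rwa [if_pos (by omega)]
      rw [hite' _ (by omega)] at this
      omega
    have hhigh : ∀ i, m < i → i ≤ k → d i = 0 := by
      intro i hmi hik
      by_contra hne
      have : ∑ j ∈ Icc 1 k, (if j ≤ m then r j else 0) ≤ ∑ j ∈ Icc 1 k, d j := by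
        refine sum_le_sum fun j hj => ?_
        rw [mem_Icc] at hj
        split_ifs with h
        · by_contra hlt
          exact hne (hdown j hj.1 (by omega) i (by omega) hik)
        · exact Nat.zero_le _
      rw [hite' _ hmk] at this
      omega
    have hdual : ∑ i ∈ Icc 1 k, ((i : ℤ) - m) * (d i : ℤ)
        = ∑ i ∈ Icc 1 m, ((i : ℤ) - m) * (r i : ℤ) := by
      rw [← hite m _ hmk]
      refine sum_congr rfl fun i hi => ?_
      rw [mem_Icc] at hi
      rcases lt_trichotomy i m with h | rfl | h
      · rw [if_pos h.le, hlow i hi.1 h]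
      · simp
      · rw [if_neg (by omega), hhigh i h hi.2, Nat.cast_zero, mul_zero]
    simp only [sub_mul, sum_sub_distrib, ← mul_sum] at hdual
    rw [← Nat.cast_sum (Icc 1 k), hsum] at hdual
    rw [mul_sub] at hW
    omega

/-- Below a configuration there are at least as many values as its excess weight. -/
theorem exists_finset_lower {k m α : ℕ} {a : ℕ → ℤ} {r : ℕ → ℕ}
    (ha : ∀ i j, 1 ≤ i → i < j → j ≤ k → a i < a j) (hpos : ∀ i, 1 ≤ i → i ≤ k → 0 < a i)
    (hr : ∀ i, 1 ≤ i → i ≤ k → 0 < r i) (hmk : m ≤ k)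
    (hm1 : ∑ i ∈ Icc 1 (m - 1), r i ≤ α) (hm2 : α < ∑ i ∈ Icc 1 m, r i) (n : ℕ) :
    ∀ d : ℕ → ℕ, (∀ i ∈ Icc 1 k, d i ≤ r i) → α ≤ ∑ i ∈ Icc 1 k, d i →
      ∑ i ∈ Icc 1 m, (i : ℤ) * (r i : ℤ) - (m : ℤ) * ((∑ i ∈ Icc 1 m, (r i : ℤ)) - α) + n
        ≤ ∑ i ∈ Icc 1 k, (i : ℤ) * (d i : ℤ) →
      ∃ F : Finset ℤ, F.card = n ∧ (∀ x ∈ F, x < ∑ i ∈ Icc 1 k, a i * (d i : ℤ)) ∧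
        F ⊆ SeqSubAlpha α (∑ i ∈ Icc 1 k, Multiset.replicate (r i) (a i)) := by
  induction n with
  | zero => exact fun _ _ _ _ => ⟨∅, by simp⟩
  | succ n ih =>
    intro d hd hα hW
    push_cast at hW
    obtain ⟨d', h1, h2, h3, h4⟩ := exists_lower ha hpos hr hmk hm1 hm2 hd hα (by omega)
    obtain ⟨F, hF1, hF2, hF3⟩ := ih d' h1 h2 (by omega)
    refine ⟨insert (∑ i ∈ Icc 1 k, a i * (d' i : ℤ)) F, ?_, ?_, ?_⟩
    · rw [card_insert_of_notMem fun h => lt_irrefl _ (hF2 _ h), hF1]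
    · intro x hx
      rcases mem_insert.1 hx with rfl | hx
      · exact h4
      · exact (hF2 x hx).trans h4
    · exact insert_subset (sum_mul_mem_seqSubAlpha a h1 h2) hF3

theorem exists_sum_mul_of_mem_hfold {k : ℕ} {a : ℕ → ℤ} (j : ℕ) :
    ∀ x ∈ hfold j (insert 0 ((Icc 1 k).image a)), ∃ c : ℕ → ℕ,
      ∑ i ∈ Icc 1 k, c i ≤ j ∧ x = ∑ i ∈ Icc 1 k, a i * (c i : ℤ) := by
  induction j with
  | zero =>
    intro x hx
    exact ⟨0, by simp, by simpa [hfold] using hx⟩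
  | succ j ih =>
    intro x hx
    obtain ⟨b, hb, y, hy, rfl⟩ := mem_add.1 (show x ∈ _ + _ from hx)
    obtain ⟨c, hc, rfl⟩ := ih y hy
    rcases mem_insert.1 hb with rfl | hb
    · exact ⟨c, by omega, zero_add _⟩
    · obtain ⟨q, hq, rfl⟩ := mem_image.1 hb
      refine ⟨fun i => c i + if i = q then 1 else 0, ?_, ?_⟩
      · rw [sum_add_distrib, sum_ite_eq', if_pos hq]
        omega
      · push_cast
        simp only [mul_add, sum_add_distrib, mul_ite, mul_one, mul_zero]
        rw [sum_ite_eq', if_pos hq, add_comm]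

end Subsequence

theorem freiman_alpha_subsequence_sum_small_alpha (k : ℕ) (hk : 3 ≤ k) (a : ℕ → ℤ) (r : ℕ → ℕ)
    (ha : ∀ i j, 1 ≤ i → i < j → j ≤ k → a i < a j)
    (hpos : ∀ i, 1 ≤ i → i ≤ k → 0 < a i)
    (hr : ∀ i, 1 ≤ i → i ≤ k → 2 ≤ r i)
    (hgcd : (Finset.Icc 1 k).gcd a = 1)
    (rr : ℕ) (hrr : rr = (Finset.Icc 1 k).inf' (Finset.nonempty_Icc.mpr (by omega)) r)
    (α : ℕ) (hα1 : 1 ≤ α) (hα2 : α < (∑ i ∈ Finset.Icc 1 k, r i) - rr) :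
    ∃ m : ℕ, 1 ≤ m ∧ m ≤ k ∧
      (∑ i ∈ Finset.Icc 1 (m - 1), r i) ≤ α ∧ α < ∑ i ∈ Finset.Icc 1 m, r i ∧
      ((hfold (rr - 1) (insert 0 ((Finset.Icc 1 k).image a))).card : ℤ)
        + min (a k) ((rr : ℤ) * ((k : ℤ) - 1) + 1)
        + ∑ i ∈ Finset.Icc 1 (k - 1), (i : ℤ) * (r i : ℤ)
        - ∑ i ∈ Finset.Icc 1 m, (i : ℤ) * (r i : ℤ)
        + (m : ℤ) * ((∑ i ∈ Finset.Icc 1 m, (r i : ℤ)) - (α : ℤ))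
        + (k : ℤ) * ((r k : ℤ) - (rr : ℤ))
        ≤ ((SeqSubAlpha α (∑ i ∈ Finset.Icc 1 k, Multiset.replicate (r i) (a i))).card : ℤ) := by
  have hrle : ∀ i ∈ Finset.Icc 1 k, rr ≤ r i := fun i hi => hrr ▸ Finset.inf'_le r hi
  have hkk : k ∈ Finset.Icc 1 k := Finset.mem_Icc.2 ⟨by omega, le_rfl⟩
  have hrr2 : 2 ≤ rr := by
    rw [hrr, Finset.le_inf'_iff]
    exact fun i hi => hr i (Finset.mem_Icc.1 hi).1 (Finset.mem_Icc.1 hi).2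
  have hr0 : ∀ i, 1 ≤ i → i ≤ k → 0 < r i := fun i h1 h2 => by
    have := hr i h1 h2
    omega
  have hex : ∃ m, α < ∑ i ∈ Finset.Icc 1 m, r i := ⟨k, by omega⟩
  classical
  set m := Nat.find hex with hm
  have hm2 : α < ∑ i ∈ Finset.Icc 1 m, r i := Nat.find_spec hex
  have hmk : m ≤ k := Nat.find_min' hex (by omega)
  have hm0 : 1 ≤ m := by
    by_contra h
    have h0 : m = 0 := by omega
    rw [h0] at hm2
    simp at hm2
  have hm1 : ∑ i ∈ Finset.Icc 1 (m - 1), r i ≤ α :=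
    not_lt.1 (Nat.find_min hex (by omega : m - 1 < Nat.find hex))
  refine ⟨m, hm0, hmk, hm1, hm2, ?_⟩
  set S := SeqSubAlpha α (∑ i ∈ Finset.Icc 1 k, Multiset.replicate (r i) (a i)) with hS
  set B := insert 0 ((Finset.Icc 1 k).image a) with hB
  obtain ⟨j, rfl⟩ : ∃ j, rr = j + 2 := ⟨rr - 2, by omega⟩
  have hlev := card_hfold_add_min_le (by omega : 1 ≤ k) ha hpos hgcd j
  rw [← hB] at hlev
  set d : ℕ → ℕ := fun i => r i - if i = k then j + 2 else 0 with hd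
  have hdz : ∀ f : ℕ → ℤ, ∑ i ∈ Finset.Icc 1 k, f i * (d i : ℤ)
      = ∑ i ∈ Finset.Icc 1 k, f i * (r i : ℤ) - f k * ((j + 2 : ℕ) : ℤ) := by
    intro f
    have hpt : ∀ i ∈ Finset.Icc 1 k, f i * (d i : ℤ)
        = f i * (r i : ℤ) - if i = k then f i * ((j + 2 : ℕ) : ℤ) else 0 := by
      intro i hi
      have := hrle i hi
      by_cases h : i = k
      · simp only [hd, if_pos h]
        rw [Nat.cast_sub this, mul_sub]
      · simp [hd, if_neg h]
    rw [Finset.sum_congr rfl hpt, Finset.sum_sub_distrib, Finset.sum_ite_eq', if_pos hkk]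
  have hdr : ∀ i ∈ Finset.Icc 1 k, d i ≤ r i := fun i _ => Nat.sub_le _ _
  have hdα : α ≤ ∑ i ∈ Finset.Icc 1 k, d i := by
    have := hdz fun _ => 1
    simp only [one_mul] at this
    rw [← Nat.cast_sum, ← Nat.cast_sum] at this
    omega
  have hdW := hdz fun i => (i : ℤ)
  have hsplit : ∑ i ∈ Finset.Icc 1 k, (i : ℤ) * (r i : ℤ)
      = ∑ i ∈ Finset.Icc 1 (k - 1), (i : ℤ) * (r i : ℤ) + (k : ℤ) * (r k : ℤ) := by
    obtain ⟨k', rfl⟩ : ∃ k', k = k' + 1 := ⟨k - 1, by omega⟩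
    rw [Finset.sum_Icc_succ_top (by omega), Nat.add_sub_cancel]
  set W := ∑ i ∈ Finset.Icc 1 m, (i : ℤ) * (r i : ℤ)
    - (m : ℤ) * ((∑ i ∈ Finset.Icc 1 m, (r i : ℤ)) - α) with hW
  obtain ⟨F, hF1, hF2, hF3⟩ : ∃ F : Finset ℤ,
      ∑ i ∈ Finset.Icc 1 k, (i : ℤ) * (d i : ℤ) - W ≤ F.card ∧
      (∀ x ∈ F, x < ∑ i ∈ Finset.Icc 1 k, a i * (d i : ℤ)) ∧ F ⊆ S := by
    by_cases hle : W ≤ ∑ i ∈ Finset.Icc 1 k, (i : ℤ) * (d i : ℤ)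
    · obtain ⟨F, hF1, hF2, hF3⟩ := exists_finset_lower ha hpos hr0 hmk hm1 hm2
        (∑ i ∈ Finset.Icc 1 k, (i : ℤ) * (d i : ℤ) - W).toNat d hdr hdα
        (by rw [← hW]; omega)
      exact ⟨F, by omega, hF2, hF3⟩
    · exact ⟨∅, by simp; omega, by simp, Finset.empty_subset _⟩
  set T := ∑ i ∈ Finset.Icc 1 k, a i * (r i : ℤ) with hT
  have hda := hdz a
  have hfoldS : (hfold (j + 2) B).image (fun x => T - x) ⊆ S := by
    intro z hz
    obtain ⟨x, hx, rfl⟩ := Finset.mem_image.1 hz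
    obtain ⟨c, hc, rfl⟩ := exists_sum_mul_of_mem_hfold (j + 2) x hx
    have hcr : ∀ i ∈ Finset.Icc 1 k, c i ≤ r i := fun i hi =>
      ((Finset.single_le_sum (fun _ _ => Nat.zero_le _) hi).trans hc).trans (hrle i hi)
    have hval : T - ∑ i ∈ Finset.Icc 1 k, a i * (c i : ℤ)
        = ∑ i ∈ Finset.Icc 1 k, a i * ((r i - c i : ℕ) : ℤ) := by
      rw [hT, ← Finset.sum_sub_distrib]
      exact Finset.sum_congr rfl fun i hi => by rw [Nat.cast_sub (hcr i hi), mul_sub]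
    have hcard := Finset.sum_tsub_distrib (Finset.Icc 1 k) hcr
    simp only [hval]
    exact sum_mul_mem_seqSubAlpha a (d := fun i => r i - c i) (fun i _ => Nat.sub_le _ _) (by omega)
  have hfold_le : ∀ x ∈ hfold (j + 2) B, x ≤ a k * ((j + 2 : ℕ) : ℤ) := by
    intro x hx
    obtain ⟨c, hc, rfl⟩ := exists_sum_mul_of_mem_hfold (j + 2) x hx
    calc ∑ i ∈ Finset.Icc 1 k, a i * (c i : ℤ)
        ≤ ∑ i ∈ Finset.Icc 1 k, a k * (c i : ℤ) := by
          refine Finset.sum_le_sum fun i hi => mul_le_mul_of_nonneg_right ?_ (Nat.cast_nonneg _)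
          rw [Finset.mem_Icc] at hi
          rcases hi.2.eq_or_lt with rfl | h
          · exact le_rfl
          · exact (ha i k hi.1 h le_rfl).le
      _ = a k * ((∑ i ∈ Finset.Icc 1 k, c i : ℕ) : ℤ) := by rw [← Finset.mul_sum, Nat.cast_sum]
      _ ≤ a k * ((j + 2 : ℕ) : ℤ) :=
          mul_le_mul_of_nonneg_left (by exact_mod_cast hc) (hpos k (by omega) le_rfl).le
  have hdisj : Disjoint ((hfold (j + 2) B).image fun x => T - x) F := by
    rw [Finset.disjoint_left]
    intro z hz hzF
    obtain ⟨x, hx, rfl⟩ := Finset.mem_image.1 hz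
    have h1 := hF2 _ hzF
    have h2 := hfold_le x hx
    rw [hda] at h1
    omega
  have hcard := Finset.card_le_card (Finset.union_subset hfoldS hF3)
  rw [Finset.card_union_of_disjoint hdisj,
    Finset.card_image_of_injective _ (fun x y h => by simpa using h)] at hcard
  rw [show j + 2 - 1 = j + 1 from rfl]
  rw [mul_sub (k : ℤ)]
  omega
end

section
/- Let k ≥ 4 and 𝔸 a finite multiset of nonnegative integers with distinct values 0 = a_0 < a_1 < ... < a_{k-1}, multiplicities r_0, ..., r_{k-1} ≥ 1, gcd(a_1, ..., a_{k-1}) = 1, r = min{r_1, ..., r_{k-1}}, and α = Σ_{i=0}^{k-1} r_i - 2. If r = 1, then |S_α(𝔸)| ≥ a_{k-1} + k - 1 when a_{k-1} ≤ 2k - 5, and |S_α(𝔸)| ≥ (θ+1)k - 5 when a_{k-1} ≥ 2k - 4, where θ = (1+√5)/2. If r ≥ 2, then |S_α(𝔸)| ≥ a_{k-1} + k when a_{k-1} ≤ 2k - 3, and |S_α(𝔸)| ≥ 3k - 3 when a_{k-1} ≥ 2k - 2. -/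
open Pointwise

/-- Scherk's theorem: if `0` has a unique representation in `A + B`, the sumset is large. -/
theorem scherk {G : Type*} [AddCommGroup G] [Finite G] [DecidableEq G] (A B : Finset G)
    (hA : 0 ∈ A) (hB : 0 ∈ B) (h : ∀ a ∈ A, ∀ b ∈ B, a + b = 0 → a = 0) :
    A.card + B.card ≤ (A + B).card + 1 := by
  induction hn : B.card using Nat.strong_induction_on generalizing A B with
  | _ n ih =>
  subst hn
  by_cases hsub : A + B ⊆ A
  · have hB0 : B = {0} := by
      refine Finset.eq_singleton_iff_unique_mem.2 ⟨hB, fun b hb => ?_⟩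
      have hmul : ∀ j : ℕ, j • b ∈ A := by
        intro j
        induction j with
        | zero => simpa using hA
        | succ j hj => rw [succ_nsmul]; exact hsub (Finset.add_mem_add hj hb)
      have hpos := addOrderOf_pos b
      have hsum : (addOrderOf b - 1) • b + b = 0 := by
        rw [← succ_nsmul, Nat.sub_add_cancel hpos, addOrderOf_nsmul_eq_zero]
      have h0 := h _ (hmul _) b hb hsum
      rwa [h0, zero_add] at hsum
    simp [hB0]
  · obtain ⟨z, hz, hzA⟩ := Finset.not_subset.1 hsub
    obtain ⟨e, he, b, hb, rfl⟩ := Finset.mem_add.1 hz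
    set A' := A ∪ (B.image (e + ·)) with hA'
    set B' := B.filter (fun x => e + x ∈ A) with hB'
    have hlt : B'.card < B.card := by
      apply Finset.card_lt_card
      rw [Finset.ssubset_iff_of_subset (Finset.filter_subset _ _)]
      exact ⟨b, hb, by simp [hzA]⟩
    have hcard : A'.card + B'.card = A.card + B.card := by
      have h1 : (A ∩ B.image (e + ·)).card = B'.card := by
        rw [← Finset.card_image_of_injective B' (add_right_injective e)]
        congr 1
        ext x
        simp only [hB', Finset.mem_inter, Finset.mem_image, Finset.mem_filter]
        constructor
        · rintro ⟨hx, y, hy, rfl⟩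
          exact ⟨y, ⟨hy, hx⟩, rfl⟩
        · rintro ⟨y, ⟨hy, hx⟩, rfl⟩
          exact ⟨hx, y, hy, rfl⟩
      have h2 := Finset.card_union_add_card_inter A (B.image (e + ·))
      rw [h1, Finset.card_image_of_injective B (add_right_injective e)] at h2
      exact h2
    have hle : A' + B' ⊆ A + B := by
      intro x hx
      obtain ⟨p, hp, q, hq, rfl⟩ := Finset.mem_add.1 hx
      simp only [hB', Finset.mem_filter] at hq
      simp only [hA', Finset.mem_union, Finset.mem_image] at hp
      rcases hp with hp | ⟨y, hy, rfl⟩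
      · exact Finset.add_mem_add hp hq.1
      · rw [show e + y + q = (e + q) + y by abel]
        exact Finset.add_mem_add hq.2 hy
    have hi := ih _ hlt A' B' (by simp [hA', hA]) (by simp [hB', hB, he]) ?_ rfl
    · have := Finset.card_le_card hle
      omega
    · intro p hp q hq hpq
      simp only [hB', Finset.mem_filter] at hq
      simp only [hA', Finset.mem_union, Finset.mem_image] at hp
      rcases hp with hp | ⟨y, hy, rfl⟩
      · exact h p hp q hq.1 hpq
      · have h1 : (e + q) + y = 0 := by rw [← hpq]; abel
        have h2 := h _ hq.2 y hy h1
        rw [h2, zero_add] at h1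
        subst h1
        exact h _ (by simpa using he) q hq.1 hpq

/-- Mann's theorem: the isoperimetric number of `S` is attained by a subgroup. -/
theorem exists_subgroup_isoperimetric {G : Type*} [AddCommGroup G] [Fintype G] [DecidableEq G]
    (S X : Finset G) (hX : X.Nonempty) (hXS : X + S ≠ Finset.univ) :
    ∃ (H : AddSubgroup G) (F : Finset G), (∀ x, x ∈ F ↔ x ∈ H) ∧ F + S ≠ Finset.univ ∧
      ∀ Y : Finset G, Y.Nonempty → Y + S ≠ Finset.univ →
        (F + S).card + Y.card ≤ (Y + S).card + F.card := by
  classical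
  -- admissible sets
  let adm : Finset (Finset G) :=
    Finset.univ.filter fun Y => Y.Nonempty ∧ Y + S ≠ Finset.univ
  have hadm : ∀ Y, Y ∈ adm ↔ Y.Nonempty ∧ Y + S ≠ Finset.univ := by simp [adm]
  let d : Finset G → ℤ := fun Y => ((Y + S).card : ℤ) - Y.card
  obtain ⟨F₀, hF₀, hmin₀⟩ := Finset.exists_min_image adm d ⟨X, (hadm X).2 ⟨hX, hXS⟩⟩
  let frag : Finset (Finset G) := adm.filter fun Y => d Y = d F₀
  obtain ⟨F, hF, hmin⟩ := Finset.exists_min_image frag Finset.card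
    ⟨F₀, by simp [frag, hF₀]⟩
  obtain ⟨hFa, hFd⟩ : F ∈ adm ∧ d F = d F₀ := by simpa [frag] using hF
  have hd : ∀ Y ∈ adm, d F ≤ d Y := fun Y hY => hFd ▸ hmin₀ Y hY
  have hcardmin : ∀ Y ∈ adm, d Y ≤ d F → F.card ≤ Y.card := fun Y hY hle =>
    hmin Y (by simp only [frag, Finset.mem_filter]
               exact ⟨hY, le_antisymm (hFd ▸ hle) (hmin₀ Y hY)⟩)
  obtain ⟨hFn, hFu⟩ := (hadm F).1 hFa
  -- the dual fragment gives `2 |F| + d F ≤ |G|`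
  have hdual : 2 * (F.card : ℤ) + d F ≤ Fintype.card G := by
    set K : Finset G := ((F + S)ᶜ).image (fun x => -x) with hK
    have hKc : K.card = Fintype.card G - (F + S).card := by
      rw [hK, Finset.card_image_of_injective _ neg_injective, Finset.card_compl]
    have hle := Finset.card_le_univ (F + S)
    have hsub : K + S ⊆ (F.image (fun x => -x))ᶜ := by
      intro x hx
      obtain ⟨y, hy, s, hs, rfl⟩ := Finset.mem_add.1 hx
      simp only [hK, Finset.mem_image, Finset.mem_compl] at hy
      obtain ⟨z, hz, rfl⟩ := hy
      simp only [Finset.mem_compl, Finset.mem_image, not_exists, not_and]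
      intro f hf hfe
      apply hz
      rw [show z = f + s by rw [eq_comm, ← neg_inj, neg_add, hfe]; abel]
      exact Finset.add_mem_add hf hs
    have hc := Finset.card_le_card hsub
    rw [Finset.card_compl, Finset.card_image_of_injective _ neg_injective] at hc
    have hle2 := Finset.card_le_univ F
    have hKa : K ∈ adm := by
      rw [hadm]
      constructor
      · rw [hK, Finset.image_nonempty]
        by_contra hne
        rw [Finset.not_nonempty_iff_eq_empty, Finset.compl_eq_empty_iff] at hne
        exact hFu hne
      · intro hu
        rw [hu] at hsub
        obtain ⟨f, hf⟩ := hFn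
        have := hsub (Finset.mem_univ (-f))
        simp [hf] at this
    have := hcardmin K hKa (by simp only [d]; omega)
    simp only [d]
    omega
  have htrans : ∀ g : G, F.image (· + g) ∈ adm ∧ d (F.image (· + g)) = d F ∧
      (F.image (· + g)).card = F.card := by
    intro g
    have hc : (F.image (· + g)).card = F.card :=
      Finset.card_image_of_injective _ (add_left_injective g)
    have he : F.image (· + g) + S = (F + S).image (· + g) := by
      ext x
      simp only [Finset.mem_add, Finset.mem_image]
      constructor
      · rintro ⟨_, ⟨f, hf, rfl⟩, s, hs, rfl⟩
        exact ⟨f + s, ⟨f, hf, s, hs, rfl⟩, by abel⟩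
      · rintro ⟨_, ⟨f, hf, s, hs, rfl⟩, rfl⟩
        exact ⟨f + g, ⟨f, hf, rfl⟩, s, hs, by abel⟩
    have hc2 : (F.image (· + g) + S).card = (F + S).card := by
      rw [he, Finset.card_image_of_injective _ (add_left_injective g)]
    refine ⟨(hadm _).2 ⟨hFn.image _, fun hu => hFu ?_⟩, by simp only [d, hc, hc2], hc⟩
    rw [← Finset.card_eq_iff_eq_univ] at hu ⊢
    rw [← hc2, hu]
  have hinter : ∀ g : G, (F ∩ F.image (· + g)).Nonempty → F.image (· + g) = F := by
    intro g hg
    obtain ⟨ha, hdg, hcg⟩ := htrans g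
    set K := F.image (· + g)
    have hi_adm : F ∩ K ∈ adm := by
      rw [hadm]
      refine ⟨hg, fun hu => hFu ?_⟩
      rw [← Finset.univ_subset_iff, ← hu]
      exact Finset.add_subset_add_right Finset.inter_subset_left
    have hsubmod : ((F ∩ K) + S).card + ((F ∪ K) + S).card ≤ (F + S).card + (K + S).card := by
      have h1 : (F ∩ K) + S ⊆ (F + S) ∩ (K + S) := Finset.inter_add_subset
      have h2 : (F ∪ K) + S = (F + S) ∪ (K + S) := Finset.union_add
      rw [h2, ← Finset.card_union_add_card_inter (F + S) (K + S)]
      have := Finset.card_le_card h1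
      omega
    have hcu := Finset.card_union_add_card_inter F K
    have hdi := hd _ hi_adm
    have hgpos := hg.card_pos
    have hdi_le : d (F ∩ K) ≤ d F := by
      by_cases hu : (F ∪ K) + S = Finset.univ
      · rw [hu, Finset.card_univ] at hsubmod
        simp only [d] at *
        omega
      · have := hd (F ∪ K) ((hadm _).2 ⟨hFn.mono Finset.subset_union_left, hu⟩)
        simp only [d] at *
        omega
    have hle := hcardmin _ hi_adm hdi_le
    have e1 := Finset.eq_of_subset_of_card_le (Finset.inter_subset_left (s₁ := F) (s₂ := K)) hle
    have e2 := Finset.eq_of_subset_of_card_le (Finset.inter_subset_right (s₁ := F) (s₂ := K))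
      (by omega)
    rw [← e2, e1]
  obtain ⟨f, hf⟩ := hFn
  set K := F.image (· + -f) with hKdef
  have hmemK : ∀ x, x ∈ K ↔ x + f ∈ F := by
    intro x
    simp only [hKdef, Finset.mem_image]
    constructor
    · rintro ⟨y, hy, rfl⟩; simpa using hy
    · intro h; exact ⟨x + f, h, by abel⟩
  have hperiod : ∀ x ∈ K, ∀ y, y ∈ K ↔ y + x ∈ K := by
    intro x hx y
    have hx' := (hmemK x).1 hx
    have := hinter x ⟨x + f, by
      rw [Finset.mem_inter, Finset.mem_image]
      exact ⟨hx', f, hf, by abel⟩⟩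
    rw [hmemK, hmemK]
    constructor
    · intro hy
      rw [← this, Finset.mem_image]
      exact ⟨_, hy, by abel⟩
    · intro hy
      rw [← this, Finset.mem_image] at hy
      obtain ⟨z, hz, hze⟩ := hy
      rwa [show y + f = z by
        apply add_right_cancel (b := x); rw [hze]; abel]
  have hK0 : (0 : G) ∈ K := by simpa [hmemK] using hf
  obtain ⟨ha, hdK, hcK⟩ := htrans (-f)
  refine ⟨{ carrier := K
            zero_mem' := by simpa using hK0
            add_mem' := fun {a b} ha hb => ?_
            neg_mem' := fun {a} ha => ?_ }, K, fun x => Iff.rfl, ((hadm _).1 ha).2, ?_⟩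
  · exact (hperiod b (by simpa using hb) a).1 (by simpa using ha)
  · have ha' : a ∈ K := by simpa using ha
    exact (hperiod a ha' (-a)).2 (by simpa using hK0)
  · intro Y hY hYS
    have hle : d K ≤ d Y := hdK.le.trans (hd Y ((hadm _).2 ⟨hY, hYS⟩))
    simp only [d] at hle
    omega

theorem card_le_two_of_double_eq {G : Type*} [AddCommGroup G]
    (hinv : ∀ x y : G, x + x = 0 → y + y = 0 → x ≠ 0 → y ≠ 0 → x = y)
    {Q : Finset G} {c : G} (hQ : ∀ x ∈ Q, x + x = c) : Q.card ≤ 2 := by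
  by_contra! h
  obtain ⟨x, y, z, hx, hy, hz, hxy, hxz, hyz⟩ := Finset.two_lt_card_iff.1 h
  have := hinv (y - x) (z - x)
    (by rw [show y - x + (y - x) = (y + y) - (x + x) by abel, hQ x hx, hQ y hy, sub_self])
    (by rw [show z - x + (z - x) = (z + z) - (x + x) by abel, hQ x hx, hQ z hz, sub_self])
    (sub_ne_zero.2 hxy.symm) (sub_ne_zero.2 hxz.symm)
  exact hyz (sub_left_injective this)

section RestrictedSums

variable {G : Type*} [AddCommGroup G] [DecidableEq G]

/-- The sums of two distinct elements of `A`, together with `0`. -/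
def distinctSums (A : Finset G) : Finset G :=
  insert 0 (((A ×ˢ A).filter fun p => p.1 ≠ p.2).image fun p => p.1 + p.2)

theorem add_mem_distinctSums {A : Finset G} {x y : G} (hx : x ∈ A) (hy : y ∈ A) (hxy : x ≠ y) :
    x + y ∈ distinctSums A :=
  Finset.mem_insert_of_mem (Finset.mem_image.2 ⟨(x, y), by simp [hx, hy, hxy], rfl⟩)

theorem subset_distinctSums {A : Finset G} (h0 : 0 ∈ A) : A ⊆ distinctSums A := by
  intro x hx
  by_cases hx0 : x = 0
  · simp [hx0, distinctSums]
  · simpa using add_mem_distinctSums hx h0 hx0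

theorem distinctSums_subset {A : Finset G} (h0 : 0 ∈ A) : distinctSums A ⊆ A + A := by
  intro x hx
  simp only [distinctSums, Finset.mem_insert, Finset.mem_image, Finset.mem_filter,
    Finset.mem_product, Prod.exists] at hx
  rcases hx with rfl | ⟨a, b, ⟨⟨ha, hb⟩, -⟩, rfl⟩
  · simpa using Finset.add_mem_add h0 h0
  · exact Finset.add_mem_add ha hb

/-- The elements of `A` whose double is not a sum of two distinct elements of `A`. -/
def lonely (A : Finset G) : Finset G := A.filter fun e => e + e ∉ distinctSums A

theorem mem_lonely {A : Finset G} {e : G} :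
    e ∈ lonely A ↔ e ∈ A ∧ e + e ∉ distinctSums A := by
  simp [lonely]

theorem eq_of_add_eq_lonely {A : Finset G} {e x y : G} (he : e ∈ lonely A) (hx : x ∈ A)
    (hy : y ∈ A) (h : x + y = e + e) : x = y := by
  by_contra hxy
  exact (mem_lonely.1 he).2 (h ▸ add_mem_distinctSums hx hy hxy)

/-- The elements of `A` taking part in a representation of `s` as a sum of two elements of `A`. -/
def summands (A : Finset G) (s : G) : Finset G := A.filter fun x => s - x ∈ A

theorem mem_summands {A : Finset G} {s x : G} : x ∈ summands A s ↔ x ∈ A ∧ s - x ∈ A := by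
  simp [summands]

/-- The elements of `summands A (e + e')` with the same double as `e`. -/
def twins (A : Finset G) (e e' : G) : Finset G :=
  (summands A (e + e')).filter fun x => x + x = e + e

theorem card_sumset_union {A : Finset G} {e e' : G} (he : e ∈ lonely A) :
    A.card + (summands A (e + e')).card ≤
      ((A.image (· + e')) ∪ ((summands A (e + e')).image (· + e))).card + (twins A e e').card := by
  have h1 : (A.image (· + e')) ∩ ((summands A (e + e')).image (· + e)) ⊆
      (twins A e e').image (· + e') := by
    intro z hz
    simp only [Finset.mem_inter, Finset.mem_image] at hz ⊢
    obtain ⟨⟨x, hx, rfl⟩, p, hp, hpe⟩ := hz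
    refine ⟨x, ?_, rfl⟩
    obtain ⟨hpA, hpA'⟩ := mem_summands.1 hp
    have hsum : x + (e + e' - p) = e + e := by
      rw [show x + (e + e' - p) = (x + e') + e - p by abel, ← hpe]; abel
    have hxp := eq_of_add_eq_lonely he hx hpA' hsum
    simp only [twins, Finset.mem_filter, mem_summands]
    refine ⟨⟨hx, ?_⟩, ?_⟩
    · rw [hxp]; simpa using hpA
    · rw [← hsum, ← hxp]
  have h2 := Finset.card_le_card h1
  have h3 : ((twins A e e').image (· + e')).card ≤ _ := Finset.card_image_le
  have h4 := Finset.card_union_add_card_inter (A.image (· + e'))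
    ((summands A (e + e')).image (· + e))
  rw [Finset.card_image_of_injective _ (add_left_injective e'),
    Finset.card_image_of_injective _ (add_left_injective e)] at h4
  omega

theorem sumset_union_subset {A : Finset G} {e e' : G} (he : e ∈ A) (he' : e' ∈ A) :
    (A.image (· + e')) ∪ ((summands A (e + e')).image (· + e)) ⊆
      insert (e + e) (insert (e' + e') (distinctSums A)) := by
  have key : ∀ c ∈ A, ∀ x ∈ A, x + c = c + c ∨ x + c ∈ distinctSums A := by
    intro c hc x hx
    by_cases h : x = c
    · left; rw [h]
    · right; exact add_mem_distinctSums hx hc h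
  intro z hz
  simp only [Finset.mem_union, Finset.mem_image] at hz
  simp only [Finset.mem_insert]
  rcases hz with ⟨x, hx, rfl⟩ | ⟨x, hx, rfl⟩
  · rcases key e' he' x hx with h | h
    · exact Or.inr (Or.inl h)
    · exact Or.inr (Or.inr h)
  · rcases key e he x (mem_summands.1 hx).1 with h | h
    · exact Or.inl h
    · exact Or.inr (Or.inr h)

/-- The lonely elements sharing their double with another element of `A`. -/
def paired (A : Finset G) : Finset G :=
  (lonely A).filter fun e => ∃ f ∈ A, f ≠ e ∧ f + f = e + e

theorem mem_paired {A : Finset G} {e : G} :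
    e ∈ paired A ↔ e ∈ lonely A ∧ ∃ f ∈ A, f ≠ e ∧ f + f = e + e := by
  simp [paired]

theorem double_paired_of_tight
    (hinv : ∀ x y : G, x + x = 0 → y + y = 0 → x ≠ 0 → y ≠ 0 → x = y)
    {A : Finset G} {e e' f g : G} (he : e ∈ lonely A) (he' : e' ∈ A)
    (hf : f ∈ summands A (e + e')) (hfe : f ≠ e) (hff : f + f = e + e)
    (hcard : (insert (e + e) (insert (e' + e') (distinctSums A))).card ≤
      ((A.image (· + e')) ∪ ((summands A (e + e')).image (· + e))).card)
    (hg : g ∈ paired A) : g + g = e + e ∨ g + g = e' + e' := by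
  have heq := Finset.eq_of_subset_of_card_le
    (sumset_union_subset (mem_lonely.1 he).1 he') hcard
  obtain ⟨hfA, hfA'⟩ := mem_summands.1 hf
  obtain ⟨hgl, g', hg'A, hgne, hgg⟩ := mem_paired.1 hg
  have h2 : (f - e) + (f - e) = 0 := by
    rw [show (f - e) + (f - e) = (f + f) - (e + e) by abel, hff, sub_self]
  have hgh : g' - g = f - e := by
    refine hinv _ _ ?_ h2 (sub_ne_zero.2 hgne) (sub_ne_zero.2 hfe)
    rw [show (g' - g) + (g' - g) = (g' + g') - (g + g) by abel, hgg, sub_self]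
  have hsum : f + (e + e' - f) = e + e' := by abel
  have hf'2 : (e + e' - f) + (e + e' - f) = e' + e' := by
    rw [show (e + e' - f) + (e + e' - f) = (e' + e') - ((f - e) + (f - e)) by abel, h2, sub_zero]
  have hf'h : e + e' - f = e' + (f - e) := by
    rw [show e + e' - f = e' + (f - e) - ((f - e) + (f - e)) by abel, h2, sub_zero]
  have hsub := sumset_union_subset hfA hfA'
  rw [hsum, hff, hf'2] at hsub
  have hmem : g + g' ∈ insert (e + e) (insert (e' + e') (distinctSums A)) := by
    simp only [Finset.mem_insert]
    exact Or.inr (Or.inr (add_mem_distinctSums (mem_lonely.1 hgl).1 hg'A hgne.symm))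
  rw [← heq] at hmem
  have hshift : g + g ∈ insert (e + e) (insert (e' + e') (distinctSums A)) := by
    have hgg' : g + g = g + g' + (f - e) := by
      rw [← hgh, show g + g' + (g' - g) = g' + g' by abel, hgg]
    rw [hgg']
    apply hsub
    simp only [Finset.mem_union, Finset.mem_image] at hmem ⊢
    rcases hmem with ⟨x, hx, hxe⟩ | ⟨x, hx, hxe⟩
    · left; exact ⟨x, hx, by rw [← hxe, hf'h]; abel⟩
    · right; exact ⟨x, hx, by rw [← hxe]; abel⟩
  simp only [Finset.mem_insert] at hshift
  rcases hshift with h | h | h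
  · exact Or.inl h
  · exact Or.inr h
  · exact absurd h (mem_lonely.1 hgl).2

theorem card_twins_le_two
    (hinv : ∀ x y : G, x + x = 0 → y + y = 0 → x ≠ 0 → y ≠ 0 → x = y)
    (A : Finset G) (e e' : G) : (twins A e e').card ≤ 2 :=
  card_le_two_of_double_eq hinv fun _ hx => (Finset.mem_filter.1 hx).2

theorem exists_twin_of_one_lt {A : Finset G} {e e' : G} (h : 1 < (twins A e e').card) :
    ∃ f ∈ summands A (e + e'), f ≠ e ∧ f + f = e + e := by
  obtain ⟨f, hf, hfe⟩ := Finset.exists_mem_ne h e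
  obtain ⟨h1, h2⟩ := Finset.mem_filter.1 hf
  exact ⟨f, h1, hfe, h2⟩

theorem card_summands_lonely
    (hinv : ∀ x y : G, x + x = 0 → y + y = 0 → x ≠ 0 → y ≠ 0 → x = y)
    {A : Finset G} (h0 : 0 ∈ A) {s : G} (hs : s ∈ lonely A) :
    A.card + (summands A s).card ≤ (distinctSums A).card + 3 ∧
      (A.card + (summands A s).card ≤ (distinctSums A).card + 2 ∨
        s ∈ paired A ∧ ∀ g ∈ paired A, g + g = s + s) := by
  have h1 := card_sumset_union (e' := 0) hs
  have hsub := Finset.card_le_card (sumset_union_subset (mem_lonely.1 hs).1 h0)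
  have h2 := card_twins_le_two hinv A s 0
  have h3 : (insert (s + s) (insert (0 + 0) (distinctSums A))).card ≤
      (distinctSums A).card + 1 := by
    rw [Finset.insert_eq_of_mem (a := (0 : G) + 0) (by simp [distinctSums])]
    exact Finset.card_insert_le _ _
  have e1 : (summands A (s + 0)).card = (summands A s).card := by rw [add_zero]
  by_cases hle : A.card + (summands A s).card ≤ (distinctSums A).card + 2
  · exact ⟨by omega, Or.inl hle⟩
  refine ⟨by omega, Or.inr ?_⟩
  obtain ⟨f, hf, hfe, hff⟩ := exists_twin_of_one_lt (A := A) (e := s) (e' := 0)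
    (by omega)
  refine ⟨mem_paired.2 ⟨hs, f, (mem_summands.1 hf).1, hfe, hff⟩, fun g hg => ?_⟩
  rcases double_paired_of_tight hinv hs h0 hf hfe hff (by omega) hg with h | h
  · exact h
  · exact absurd (by rw [h]; simp [distinctSums]) (mem_lonely.1 (mem_paired.1 hg).1).2

theorem popular_sum_structure
    (hinv : ∀ x y : G, x + x = 0 → y + y = 0 → x ≠ 0 → y ≠ 0 → x = y)
    {A : Finset G} (hA : 2 * A.card ≤ (distinctSums A).card + (lonely A).card + 2) {s : G}
    (hs : (distinctSums A).card + 3 < A.card + (summands A s).card) :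
    A.card + (summands A s).card ≤ (distinctSums A).card + 4 ∧
      ∃ e ∈ paired A, ∃ e' ∈ paired A, e + e' = s ∧ e + e ≠ e' + e' ∧
        ∀ g ∈ paired A, g + g = e + e ∨ g + g = e' + e' := by
  have hmeet : ∃ e ∈ summands A s, e ∈ lonely A := by
    by_contra! hno
    have hd : Disjoint (summands A s) (lonely A) := Finset.disjoint_left.2 hno
    have := Finset.card_le_card (Finset.union_subset (Finset.filter_subset _ _)
      (Finset.filter_subset _ _) : summands A s ∪ lonely A ⊆ A)
    rw [Finset.card_union_of_disjoint hd] at this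
    omega
  obtain ⟨e, heP, he⟩ := hmeet
  obtain ⟨heA, heA'⟩ := mem_summands.1 heP
  obtain ⟨e', rfl⟩ : ∃ e', s = e + e' := ⟨s - e, by abel⟩
  rw [add_sub_cancel_left] at heA'
  have h1 := card_sumset_union (e' := e') he
  have hsub := Finset.card_le_card (sumset_union_subset heA heA')
  have h2 := card_twins_le_two hinv A e e'
  have h3 := Finset.card_insert_le (e + e) (insert (e' + e') (distinctSums A))
  have h4 := Finset.card_insert_le (e' + e') (distinctSums A)
  refine ⟨by omega, ?_⟩
  obtain ⟨f, hf, hfe, hff⟩ := exists_twin_of_one_lt (A := A) (e := e) (e' := e') (by omega)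
  have he'S : e' + e' ∉ distinctSums A := fun hmem => by
    rw [Finset.insert_eq_of_mem hmem] at h3 hsub
    omega
  have hne : e + e ≠ e' + e' := fun heq => by
    rw [← heq, Finset.insert_eq_of_mem (Finset.mem_insert_self _ _)] at hsub
    have := Finset.card_insert_le (e + e) (distinctSums A)
    omega
  obtain ⟨hfA, hfA'⟩ := mem_summands.1 hf
  refine ⟨e, mem_paired.2 ⟨he, f, hfA, hfe, hff⟩, e',
    mem_paired.2 ⟨mem_lonely.2 ⟨heA', he'S⟩, e + e' - f, hfA', ?_, ?_⟩, rfl, hne, fun g hg =>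
      double_paired_of_tight hinv he heA' hf hfe hff (by omega) hg⟩
  · intro h
    apply hfe
    rw [show f = e + e' - (e + e' - f) by abel, h]; abel
  · rw [show (e + e' - f) + (e + e' - f) = (e' + e') + ((e + e) - (f + f)) by abel, hff]; abel

theorem exists_exceptional_sums
    (hinv : ∀ x y : G, x + x = 0 → y + y = 0 → x ≠ 0 → y ≠ 0 → x = y)
    {A : Finset G} (h0 : 0 ∈ A)
    (hA : 2 * A.card ≤ (distinctSums A).card + (lonely A).card + 2) :
    ∃ Q : Finset G, Q.card ≤ 2 ∧ ∀ s ∈ distinctSums A,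
      A.card + (summands A s).card + (if s ∈ lonely A then 1 else 0) ≤
        (distinctSums A).card + 3 + (if s ∈ Q then 1 else 0) := by
  by_cases hI : ∀ s ∈ lonely A, A.card + (summands A s).card ≤ (distinctSums A).card + 2
  · refine ⟨(distinctSums A).filter fun s =>
      (distinctSums A).card + 3 < A.card + (summands A s).card, ?_, fun s hs => ?_⟩
    · rcases Finset.eq_empty_or_nonempty ((distinctSums A).filter fun s =>
        (distinctSums A).card + 3 < A.card + (summands A s).card) with h | ⟨s₀, hs₀⟩
      · simp [h]
      · obtain ⟨-, e, he, e', he', -, hne, hall⟩ :=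
          popular_sum_structure hinv hA (Finset.mem_filter.1 hs₀).2
        refine card_le_two_of_double_eq hinv (c := (e + e) + (e' + e')) fun s hs => ?_
        obtain ⟨-, f, hf, f', hf', rfl, hnef, -⟩ :=
          popular_sum_structure hinv hA (Finset.mem_filter.1 hs).2
        rw [show f + f' + (f + f') = (f + f) + (f' + f') by abel]
        rcases hall f hf with h1 | h1 <;> rcases hall f' hf' with h2 | h2
        · exact absurd (h1.trans h2.symm) hnef
        · rw [h1, h2]
        · rw [h1, h2, add_comm]
        · exact absurd (h1.trans h2.symm) hnef
    · by_cases hb : (distinctSums A).card + 3 < A.card + (summands A s).card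
      · have h1 := (popular_sum_structure hinv hA hb).1
        have h2 : s ∉ lonely A := fun h => by have := hI s h; omega
        rw [if_neg h2, if_pos (Finset.mem_filter.2 ⟨hs, hb⟩)]
        omega
      · have : A.card + (summands A s).card + (if s ∈ lonely A then 1 else 0) ≤
            (distinctSums A).card + 3 := by
          split_ifs with h
          · have := hI s h; omega
          · omega
        omega
  · push Not at hI
    obtain ⟨e, he, hlt⟩ := hI
    obtain ⟨-, h | ⟨hep, hall⟩⟩ := card_summands_lonely hinv h0 he
    · omega
    refine ⟨paired A, card_le_two_of_double_eq hinv hall, fun s hs => ?_⟩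
    by_cases hsl : s ∈ lonely A
    · rw [if_pos hsl]
      obtain ⟨h1, h2 | h2⟩ := card_summands_lonely hinv h0 hsl
      · omega
      · rw [if_pos h2.1]; omega
    · rw [if_neg hsl]
      by_contra! hb
      obtain ⟨-, f, hf, f', hf', -, hne, -⟩ :=
        popular_sum_structure (s := s) hinv hA (by omega)
      exact hne ((hall f hf).trans (hall f' hf').symm)

theorem sq_card_le_sum_summands (A : Finset G) :
    A.card ^ 2 ≤ ∑ s ∈ distinctSums A, (summands A s).card + (lonely A).card := by
  rw [sq, ← Finset.card_product,
    ← Finset.card_filter_add_card_filter_not (fun p : G × G => p.1 + p.2 ∈ distinctSums A)]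
  apply add_le_add
  · rw [Finset.card_eq_sum_card_fiberwise (f := fun p : G × G => p.1 + p.2)
      (t := distinctSums A) (fun p hp => by simpa using (Finset.mem_filter.1 hp).2)]
    refine Finset.sum_le_sum fun s _ => ?_
    refine Finset.card_le_card_of_injOn Prod.fst ?_ ?_
    · rintro ⟨x, y⟩ hp
      simp only [Finset.coe_filter, Finset.mem_filter, Finset.mem_product, Set.mem_ofPred_eq] at hp
      obtain ⟨⟨⟨hx, hy⟩, -⟩, rfl⟩ := hp
      simp [mem_summands, hx, hy]
    · rintro ⟨x, y⟩ hp ⟨x', y'⟩ hp' h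
      simp only [Finset.coe_filter, Set.mem_ofPred_eq] at hp hp' h
      subst h
      have := hp.2.trans hp'.2.symm
      simpa using this
  · refine Finset.card_le_card_of_injOn Prod.fst ?_ ?_
    · rintro ⟨x, y⟩ hp
      simp only [Finset.coe_filter, Finset.mem_product, Set.mem_ofPred_eq] at hp
      obtain ⟨⟨hx, hy⟩, hn⟩ := hp
      have hxy : x = y := by
        by_contra h
        exact hn (add_mem_distinctSums hx hy h)
      subst hxy
      simpa using mem_lonely.2 ⟨hx, hn⟩
    · rintro ⟨x, y⟩ hp ⟨x', y'⟩ hp' h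
      simp only [Finset.coe_filter, Finset.mem_product, Set.mem_ofPred_eq] at hp hp' h
      have hxy : x = y := by
        by_contra h
        exact hp.2 (add_mem_distinctSums hp.1.1 hp.1.2 h)
      have hxy' : x' = y' := by
        by_contra h
        exact hp'.2 (add_mem_distinctSums hp'.1.1 hp'.1.2 h)
      rw [Prod.mk.injEq]
      exact ⟨h, by rw [← hxy, ← hxy', h]⟩

theorem two_mul_card_le_of_lonely [Finite G]
    (hinv : ∀ x y : G, x + x = 0 → y + y = 0 → x ≠ 0 → y ≠ 0 → x = y)
    {A : Finset G} (hne : (lonely A).Nonempty) :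
    2 * A.card ≤ (distinctSums A).card + (lonely A).card + 2 := by
  obtain ⟨e, he⟩ := hne
  have heA := (mem_lonely.1 he).1
  set B := A.filter fun x => x = e ∨ x + x ≠ e + e with hB
  have hBc : A.card ≤ B.card + 1 := by
    have hc : B.card + (A.filter fun x => ¬ (x = e ∨ x + x ≠ e + e)).card = A.card :=
      Finset.card_filter_add_card_filter_not _
    have h2 : (A.filter fun x => ¬ (x = e ∨ x + x ≠ e + e)).card + 1 ≤ 2 := by
      rw [← Finset.card_insert_of_notMem (a := e) (by simp)]
      refine card_le_two_of_double_eq hinv (c := e + e) fun x hx => ?_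
      simp only [Finset.mem_insert, Finset.mem_filter, not_or, not_not] at hx
      rcases hx with rfl | hx
      · rfl
      · exact hx.2.2
    omega
  have hs := scherk (A.image (· - e)) (B.image (· - e))
    (Finset.mem_image.2 ⟨e, heA, sub_self e⟩)
    (Finset.mem_image.2 ⟨e, by simp [hB, heA], sub_self e⟩) (by
      intro a ha b hb hab
      obtain ⟨x, hx, rfl⟩ := Finset.mem_image.1 ha
      obtain ⟨y, hy, rfl⟩ := Finset.mem_image.1 hb
      simp only [hB, Finset.mem_filter] at hy
      have hxy : x + y = e + e := by
        rw [← sub_eq_zero, ← hab]; abel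
      have := eq_of_add_eq_lonely he hx hy.1 hxy
      subst this
      rcases hy.2 with h | h
      · rw [h, sub_self]
      · exact absurd hxy h)
  rw [Finset.card_image_of_injective _ (sub_left_injective),
    Finset.card_image_of_injective _ (sub_left_injective)] at hs
  have hsub : A.image (· - e) + B.image (· - e) ⊆
      (distinctSums A ∪ (lonely A).image fun x => x + x).image fun x => x - (e + e) := by
    intro z hz
    obtain ⟨_, ha, _, hb, rfl⟩ := Finset.mem_add.1 hz
    obtain ⟨x, hx, rfl⟩ := Finset.mem_image.1 ha
    obtain ⟨y, hy, rfl⟩ := Finset.mem_image.1 hb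
    have hyA := (Finset.mem_filter.1 hy).1
    refine Finset.mem_image.2 ⟨x + y, ?_, by abel⟩
    rw [Finset.mem_union, Finset.mem_image]
    by_cases hxy : x = y
    · subst hxy
      by_cases h : x + x ∈ distinctSums A
      · exact Or.inl h
      · exact Or.inr ⟨x, mem_lonely.2 ⟨hx, h⟩, rfl⟩
    · exact Or.inl (add_mem_distinctSums hx hyA hxy)
  have h1 := (Finset.card_le_card hsub).trans Finset.card_image_le
  have h2 := Finset.card_union_le (distinctSums A) ((lonely A).image fun x => x + x)
  have h3 : ((lonely A).image fun x => x + x).card ≤ _ := Finset.card_image_le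
  omega

/-- A quadratic lower bound for the number of sums of distinct elements, valid when some double is
not such a sum. -/
theorem sq_card_le_of_lonely [Finite G]
    (hinv : ∀ x y : G, x + x = 0 → y + y = 0 → x ≠ 0 → y ≠ 0 → x = y)
    {A : Finset G} (h0 : 0 ∈ A) (hne : (lonely A).Nonempty) :
    A.card ^ 2 + A.card * (distinctSums A).card ≤
      (distinctSums A).card * ((distinctSums A).card + 3) + 2 := by
  obtain ⟨Q, hQ, hbound⟩ :=
    exists_exceptional_sums hinv h0 (two_mul_card_le_of_lonely hinv hne)
  have hsum := Finset.sum_le_sum hbound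
  simp only [Finset.sum_add_distrib, Finset.sum_const, smul_eq_mul, Finset.sum_boole,
    Nat.cast_id] at hsum
  have h1 : (distinctSums A).filter (· ∈ lonely A) = lonely A := by
    ext x
    simp only [Finset.mem_filter, and_iff_right_iff_imp]
    exact fun hx => subset_distinctSums h0 (mem_lonely.1 hx).1
  have h2 : ((distinctSums A).filter (· ∈ Q)).card ≤ Q.card :=
    Finset.card_le_card fun x hx => (Finset.mem_filter.1 hx).2
  rw [h1] at hsum
  have h3 := sq_card_le_sum_summands A
  nlinarith

end RestrictedSums

section Cosets

variable {G Q : Type*} [AddCommGroup G] [AddCommGroup Q] [DecidableEq Q]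

/-- The part of `A` lying over `c`. -/
def fiber (π : G →+ Q) (A : Finset G) (c : Q) : Finset G := A.filter fun x => π x = c

theorem mem_fiber {π : G →+ Q} {A : Finset G} {c : Q} {x : G} :
    x ∈ fiber π A c ↔ x ∈ A ∧ π x = c := by
  simp [fiber]

theorem sum_card_fiber (π : G →+ Q) (A : Finset G) :
    ∑ c ∈ A.image π, (fiber π A c).card = A.card :=
  (Finset.card_eq_sum_card_fiberwise fun _ hx => Finset.mem_image_of_mem _ hx).symm

variable [Fintype G]

theorem card_preimage {π : G →+ Q} {q : ℕ}
    (hq : ∀ c, (fiber π Finset.univ c).card = q) (C : Finset Q) :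
    (Finset.univ.filter fun x => π x ∈ C).card = C.card * q := by
  rw [Finset.card_eq_sum_card_fiberwise (f := π) (t := C)
    (fun x hx => by simpa using hx), Finset.sum_const_nat]
  intro c hc
  rw [← hq c]
  congr 1
  ext x
  simp only [Finset.mem_filter, mem_fiber, Finset.mem_univ, true_and]
  exact ⟨fun h => h.2, fun h => ⟨h ▸ hc, h⟩⟩

theorem card_fiber_le {π : G →+ Q} {q : ℕ} (hq : ∀ c, (fiber π Finset.univ c).card = q)
    (A : Finset G) (c : Q) : (fiber π A c).card ≤ q :=
  hq c ▸ Finset.card_le_card (Finset.filter_subset_filter _ (Finset.subset_univ A))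

variable [DecidableEq G] in
/-- If two fibers have more than `q` elements together, their sum is a whole coset. -/
theorem exists_add_eq_of_lt_card_fiber {π : G →+ Q} {q : ℕ}
    (hq : ∀ c, (fiber π Finset.univ c).card = q) {A : Finset G} {c c' : Q}
    (h : q < (fiber π A c).card + (fiber π A c').card) {g : G} (hg : π g = c + c') :
    ∃ x ∈ A, ∃ y ∈ A, π x = c ∧ π y = c' ∧ x + y = g := by
  by_contra! hno
  have hd : Disjoint (fiber π A c) ((fiber π A c').image (g - ·)) := by
    rw [Finset.disjoint_left]
    intro x hx hx'
    obtain ⟨y, hy, rfl⟩ := Finset.mem_image.1 hx'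
    rw [mem_fiber] at hx hy
    exact hno _ hx.1 y hy.1 hx.2 hy.2 (by abel)
  have hsub : fiber π A c ∪ (fiber π A c').image (g - ·) ⊆ fiber π Finset.univ c := by
    intro x hx
    rw [Finset.mem_union, Finset.mem_image] at hx
    rw [mem_fiber]
    refine ⟨Finset.mem_univ _, ?_⟩
    rcases hx with hx | ⟨y, hy, rfl⟩
    · exact (mem_fiber.1 hx).2
    · rw [map_sub, hg, (mem_fiber.1 hy).2, add_sub_cancel_right]
  have := Finset.card_le_card hsub
  rw [Finset.card_union_of_disjoint hd,
    Finset.card_image_of_injective _ (sub_right_injective), hq] at this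
  omega

theorem sum_holes {π : G →+ Q} {q : ℕ} (hq : ∀ c, (fiber π Finset.univ c).card = q)
    (A : Finset G) :
    ∑ c ∈ A.image π, (q - (fiber π A c).card) + A.card = (A.image π).card * q := by
  rw [← sum_card_fiber π A, ← Finset.sum_add_distrib, Finset.sum_const_nat]
  intro c _
  have := card_fiber_le hq A c
  omega

/-- Two distinct fibers have together at most all the holes of `A` in its cosets. -/
theorem holes_add_holes_le_s13 {π : G →+ Q} {q : ℕ} (hq : ∀ c, (fiber π Finset.univ c).card = q)
    {A : Finset G} {c c' : Q} (hc : c ∈ A.image π) (hc' : c' ∈ A.image π) (hne : c ≠ c') :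
    2 * q + A.card ≤ (fiber π A c).card + (fiber π A c').card + (A.image π).card * q := by
  have h := sum_holes hq A
  have h1 : ∑ x ∈ {c, c'}, (q - (fiber π A x).card) ≤
      ∑ x ∈ A.image π, (q - (fiber π A x).card) :=
    Finset.sum_le_sum_of_subset (by
      intro x hx
      simp only [Finset.mem_insert, Finset.mem_singleton] at hx
      rcases hx with rfl | rfl <;> assumption)
  rw [Finset.sum_pair hne] at h1
  have := card_fiber_le hq A c
  have := card_fiber_le hq A c'
  omega

/-- All fibers but one miss at most half of the holes. -/
theorem exists_exceptional_fiber {π : G →+ Q} {q : ℕ}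
    (hq : ∀ c, (fiber π Finset.univ c).card = q) {A : Finset G} (hA : A.Nonempty) :
    ∃ c₀ ∈ A.image π, ∀ c ∈ A.image π, c ≠ c₀ →
      2 * q + A.card ≤ 2 * (fiber π A c).card + (A.image π).card * q := by
  obtain ⟨c₀, hc₀, hmin⟩ := Finset.exists_min_image (A.image π)
    (fun c => (fiber π A c).card) (hA.image π)
  refine ⟨c₀, hc₀, fun c hc hne => ?_⟩
  have h1 := holes_add_holes_le_s13 hq hc hc₀ hne
  have h2 := hmin c hc
  omega

variable [DecidableEq G] in
theorem add_eq_univ_of_card_quotient {π : G →+ Q} {q : ℕ}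
    (hq : ∀ c, (fiber π Finset.univ c).card = q) {A : Finset G}
    (hall : ∀ g : G, π g ∈ A.image π + A.image π)
    (hC : (A.image π + A.image π).card + 2 ≤ 2 * (A.image π).card)
    (hA : (A.image π).card * q + 1 ≤ A.card + q) : A + A = Finset.univ := by
  have hne : A.Nonempty := by
    by_contra h
    rw [Finset.not_nonempty_iff_eq_empty] at h
    simp [h] at hC
  obtain ⟨c₀, hc₀, hexc⟩ := exists_exceptional_fiber hq hne
  rw [Finset.eq_univ_iff_forall]
  intro g
  set C := A.image π with hCdef
  have hinter : 2 ≤ (C ∩ C.image (π g - ·)).card := by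
    have h1 := Finset.card_union_add_card_inter C (C.image (π g - ·))
    rw [Finset.card_image_of_injective _ (sub_right_injective)] at h1
    have h2 : C ∪ C.image (π g - ·) ⊆ C + C := by
      intro c hc
      have hlift : ∀ c ∈ C, ∃ x : G, π x = c := fun c hc => by
        obtain ⟨x, -, hx⟩ := Finset.mem_image.1 hc
        exact ⟨x, hx⟩
      rcases Finset.mem_union.1 hc with hc | hc
      · obtain ⟨x, rfl⟩ := hlift c hc
        exact hall x
      · obtain ⟨d, hd, rfl⟩ := Finset.mem_image.1 hc
        obtain ⟨x, rfl⟩ := hlift d hd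
        rw [← map_sub]
        exact hall _
    have h3 := Finset.card_le_card h2
    omega
  obtain ⟨c, hc, hcc⟩ := Finset.exists_mem_ne hinter c₀
  obtain ⟨hc, hc'⟩ := Finset.mem_inter.1 hc
  obtain ⟨c', hc', hcc'⟩ := Finset.mem_image.1 hc'
  have hsum : π g = c' + c := by rw [← hcc']; abel
  have hlt : q < (fiber π A c').card + (fiber π A c).card := by
    by_cases h : c' = c
    · have := hexc c hc hcc
      subst h
      omega
    · have := holes_add_holes_le_s13 hq hc' hc h
      rw [← hCdef] at this
      omega
  obtain ⟨x, hx, y, hy, -, -, rfl⟩ := exists_add_eq_of_lt_card_fiber hq hlt hsum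
  exact Finset.add_mem_add hx hy

end Cosets

/-- A generating set with small sumset is nearly a union of few cosets of a proper subgroup. -/
theorem exists_quotient_of_card_add_lt {G : Type} [AddCommGroup G] [Fintype G] [DecidableEq G]
    {A : Finset G} (h0 : 0 ∈ A)
    (hgen : ∀ H : AddSubgroup G, (∀ x ∈ A, x ∈ H) → H = ⊤) (hu : A + A ≠ Finset.univ)
    (hcard : (A + A).card + 2 ≤ 2 * A.card) :
    ∃ (Q : Type) (_ : AddCommGroup Q) (_ : DecidableEq Q) (π : G →+ Q) (q : ℕ), 0 < q ∧
      (∀ c, (fiber π Finset.univ c).card = q) ∧ 2 ≤ (A.image π).card ∧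
      A.card + (A.image π).card * q ≤ (A + A).card + q ∧
      2 * (A.image π).card ≤ (A.image π + A.image π).card + 1 := by
  classical
  obtain ⟨H, F, hF, hFu, hmin⟩ := exists_subgroup_isoperimetric A A ⟨0, h0⟩ hu
  let π : G →+ G ⧸ H := QuotientAddGroup.mk' H
  have hπ : ∀ x y, π x = π y ↔ y - x ∈ H := fun x y => by
    rw [sub_eq_neg_add]; exact QuotientAddGroup.eq
  have hq : ∀ c, (fiber π Finset.univ c).card = F.card := by
    intro c
    obtain ⟨g, rfl⟩ := QuotientAddGroup.mk'_surjective H c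
    rw [← Finset.card_image_of_injective F (add_left_injective g)]
    congr 1
    ext x
    rw [mem_fiber, Finset.mem_image]
    constructor
    · rintro ⟨-, hx⟩
      exact ⟨x - g, (hF _).2 ((hπ g x).1 hx.symm), by abel⟩
    · rintro ⟨y, hy, rfl⟩
      refine ⟨Finset.mem_univ _, ((hπ g (y + g)).2 ?_).symm⟩
      rw [add_sub_cancel_right]
      exact (hF y).1 hy
  have hpre : ∀ B : Finset G, F + B = Finset.univ.filter fun x => π x ∈ B.image π := by
    intro B
    ext x
    simp only [Finset.mem_add, Finset.mem_filter, Finset.mem_univ, true_and, Finset.mem_image]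
    constructor
    · rintro ⟨y, hy, b, hb, rfl⟩
      exact ⟨b, hb, (hπ b (y + b)).2 (by rw [add_sub_cancel_right]; exact (hF y).1 hy)⟩
    · rintro ⟨b, hb, hbx⟩
      exact ⟨x - b, (hF _).2 ((hπ b x).1 hbx), b, hb, by abel⟩
  have hF0 : (0 : G) ∈ F := (hF 0).2 H.zero_mem
  have hqpos : 0 < F.card := Finset.card_pos.2 ⟨0, hF0⟩
  have hFA : (F + A).card = (A.image π).card * F.card := by
    rw [hpre, card_preimage hq]
  have h1 := hmin A ⟨0, h0⟩ hu
  rw [hFA] at h1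
  have hFAA : (F + A + A).card = (A.image π + A.image π).card * F.card := by
    rw [add_assoc, hpre, card_preimage hq, Finset.image_add]
  refine ⟨G ⧸ H, inferInstance, inferInstance, π, F.card, hqpos, hq, ?_, by omega, ?_⟩
  · by_contra! hlt
    apply hFu
    have hone : ∀ x ∈ A, x ∈ H := by
      intro x hx
      have := Finset.card_le_one.1 (by omega : (A.image π).card ≤ 1) (π 0)
        (Finset.mem_image_of_mem _ h0) (π x) (Finset.mem_image_of_mem _ hx)
      simpa using (hπ 0 x).1 this
    have hFuniv : F = Finset.univ := by
      ext x
      simp [hF, hgen H hone]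
    rw [hFuniv, Finset.eq_univ_iff_forall]
    intro x
    simpa using Finset.add_mem_add (Finset.mem_univ x) h0
  · by_cases hFu2 : F + A + A = Finset.univ
    · by_contra! hlt
      apply hu
      refine add_eq_univ_of_card_quotient hq (fun g => ?_) (by omega) (by omega)
      have hg : g ∈ F + (A + A) := by rw [← add_assoc, hFu2]; exact Finset.mem_univ g
      rw [hpre, Finset.mem_filter, Finset.image_add] at hg
      exact hg.2
    · have h2 := hmin (F + A) ⟨0 + 0, Finset.add_mem_add hF0 h0⟩ hFu2
      rw [hFA, hFAA] at h2
      nlinarith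

section Lift

theorem card_filter_add_sum_card_filter_le {α Q : Type*} [DecidableEq α] [DecidableEq Q]
    (T : Finset α) (f : α → Q) {C N : Finset Q} (hCN : Disjoint C N) :
    (T.filter fun t => f t ∈ C).card + ∑ c ∈ N, (T.filter fun t => f t = c).card ≤ T.card := by
  have h1 : ∑ c ∈ N, (T.filter fun t => f t = c).card = (T.filter fun t => f t ∈ N).card := by
    rw [Finset.card_eq_sum_card_fiberwise (f := f) (t := N)
      (fun t ht => by simpa using (Finset.mem_filter.1 ht).2)]
    refine Finset.sum_congr rfl fun c hc => ?_
    rw [Finset.filter_filter]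
    congr 1
    ext t
    simp only [Finset.mem_filter]
    exact ⟨fun h => ⟨h.1, h.2 ▸ hc, h.2⟩, fun h => ⟨h.1, h.2.2⟩⟩
  rw [h1, ← Finset.card_union_of_disjoint]
  · exact Finset.card_le_card (Finset.union_subset (Finset.filter_subset _ _)
      (Finset.filter_subset _ _))
  · rw [Finset.disjoint_left]
    intro t ht ht'
    exact Finset.disjoint_left.1 hCN (Finset.mem_filter.1 ht).2 (Finset.mem_filter.1 ht').2

theorem card_add_card_le_of_cover {l : ℕ} {T : Finset ℤ} {X Y : Finset (ZMod l)} (hl : l ≠ 0)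
    (hYX : Y ⊆ X) (hX : ∀ x ∈ X, ∃ t ∈ T, (t : ZMod l) = x)
    (hY : ∀ y ∈ Y, ∃ t ∈ T, t + l ∈ T ∧ (t : ZMod l) = y) : X.card + Y.card ≤ T.card := by
  classical
  have h1 : ∀ x ∈ X, 1 + (if x ∈ Y then 1 else 0) ≤
      (T.filter fun t : ℤ => (t : ZMod l) = x).card := by
    intro x hx
    split_ifs with h
    · obtain ⟨t, ht, ht', hx⟩ := hY x h
      rw [Nat.add_one_le_iff, Finset.one_lt_card]
      refine ⟨t, by simp [ht, hx], t + l, by simp [ht', hx], ?_⟩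
      simpa using hl
    · obtain ⟨t, ht, hx⟩ := hX x hx
      exact Finset.card_pos.2 ⟨t, by simp [ht, hx]⟩
  have h2 := Finset.sum_le_sum h1
  rw [Finset.sum_add_distrib, Finset.sum_ite_mem, Finset.inter_eq_right.2 hYX] at h2
  simp only [Finset.sum_const, smul_eq_mul, mul_one] at h2
  refine h2.trans ?_
  rw [← Finset.card_biUnion]
  · exact Finset.card_le_card (Finset.biUnion_subset.2 fun _ _ => Finset.filter_subset _ _)
  · intro x _ y _ hxy
    rw [Function.onFun, Finset.disjoint_left]
    intro t ht ht'
    exact hxy ((Finset.mem_filter.1 ht).2.symm.trans (Finset.mem_filter.1 ht').2)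

/-- The members of a set of residues mod `l` as integers in `[0, l)`, together with `l`. -/
def lift {l : ℕ} (A : Finset (ZMod l)) : Finset ℤ := insert (l : ℤ) (A.image fun x => (x.val : ℤ))

variable {l : ℕ} {A : Finset (ZMod l)}

theorem val_mem_lift {x : ZMod l} (hx : x ∈ A) : (x.val : ℤ) ∈ lift A :=
  Finset.mem_insert_of_mem (Finset.mem_image_of_mem _ hx)

theorem natCast_mem_lift : (l : ℤ) ∈ lift A := Finset.mem_insert_self _ _

theorem two_mul_mem_lift_add : (2 * l : ℤ) ∈ lift A + lift A := by
  rw [two_mul]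
  exact Finset.add_mem_add natCast_mem_lift natCast_mem_lift

variable [NeZero l]

theorem intCast_val (x : ZMod l) : ((x.val : ℤ) : ZMod l) = x := by simp

theorem val_int_injective : Function.Injective fun x : ZMod l => (x.val : ℤ) :=
  fun _ _ h => ZMod.val_injective l (Nat.cast_injective h)

theorem add_mem_distinctSums_lift {x y : ZMod l} (hx : x ∈ A) (hy : y ∈ A) (hxy : x ≠ y) :
    (x.val + y.val : ℤ) ∈ distinctSums (lift A) :=
  add_mem_distinctSums (val_mem_lift hx) (val_mem_lift hy) (val_int_injective.ne hxy)

theorem exists_distinctSums_lift {x : ZMod l} (hx : x ∈ distinctSums A) :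
    ∃ t ∈ distinctSums (lift A), (t : ZMod l) = x := by
  rw [distinctSums, Finset.mem_insert, Finset.mem_image] at hx
  rcases hx with rfl | ⟨⟨a, b⟩, hab, rfl⟩
  · exact ⟨0, by simp [distinctSums], by simp⟩
  · simp only [Finset.mem_filter, Finset.mem_product] at hab
    exact ⟨_, add_mem_distinctSums_lift hab.1.1 hab.1.2 hab.2, by simp⟩

theorem exists_double_distinctSums_lift (h0 : 0 ∈ A) {x : ZMod l} (hx : x ∈ A) :
    ∃ t ∈ distinctSums (lift A), t + l ∈ distinctSums (lift A) ∧ (t : ZMod l) = x := by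
  refine ⟨x.val, subset_distinctSums ?_ (val_mem_lift hx), ?_, by simp⟩
  · simpa using val_mem_lift h0
  · refine add_mem_distinctSums (val_mem_lift hx) natCast_mem_lift ?_
    have := ZMod.val_lt x
    omega

theorem exists_lift_add {x : ZMod l} (hx : x ∈ A + A) :
    ∃ t ∈ (lift A + lift A).erase (2 * l), (t : ZMod l) = x := by
  obtain ⟨a, ha, b, hb, rfl⟩ := Finset.mem_add.1 hx
  refine ⟨a.val + b.val, Finset.mem_erase.2 ⟨?_, ?_⟩, by simp⟩
  · have := ZMod.val_lt a
    have := ZMod.val_lt b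
    omega
  · exact Finset.add_mem_add (val_mem_lift ha) (val_mem_lift hb)

theorem exists_double_lift_add (h0 : 0 ∈ A) {x : ZMod l} (hx : x ∈ A) :
    ∃ t ∈ (lift A + lift A).erase (2 * l), t + l ∈ (lift A + lift A).erase (2 * l) ∧
      (t : ZMod l) = x := by
  have := ZMod.val_lt x
  refine ⟨x.val, Finset.mem_erase.2 ⟨by omega, ?_⟩, Finset.mem_erase.2 ⟨by omega, ?_⟩, by simp⟩
  · simpa using Finset.add_mem_add (val_mem_lift hx) (val_mem_lift h0)
  · exact Finset.add_mem_add (val_mem_lift hx) natCast_mem_lift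

theorem card_distinctSums_add_card_le (h0 : 0 ∈ A) :
    (distinctSums A).card + A.card ≤ (distinctSums (lift A)).card :=
  card_add_card_le_of_cover (NeZero.ne l) (subset_distinctSums h0)
    (fun _ => exists_distinctSums_lift) (fun _ => exists_double_distinctSums_lift h0)

theorem card_add_add_card_lt (h0 : 0 ∈ A) :
    (A + A).card + A.card + 1 ≤ (lift A + lift A).card := by
  rw [← Finset.card_erase_add_one (two_mul_mem_lift_add (A := A)), Nat.add_le_add_iff_right]
  exact card_add_card_le_of_cover (NeZero.ne l)
    ((subset_distinctSums h0).trans (distinctSums_subset h0))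
    (fun _ => exists_lift_add) (fun _ => exists_double_lift_add h0)

theorem ZMod.eq_of_add_self_eq_zero (x y : ZMod l) (hx : x + x = 0) (hy : y + y = 0)
    (hx0 : x ≠ 0) (hy0 : y ≠ 0) : x = y := by
  have key : ∀ z : ZMod l, z + z = 0 → z ≠ 0 → 2 * z.val = l := by
    intro z hz hz0
    have h1 : l ∣ 2 * z.val := by
      rw [← ZMod.natCast_eq_zero_iff]
      simpa [two_mul] using hz
    obtain ⟨c, hc⟩ := h1
    have h2 := ZMod.val_lt z
    have h3 : z.val ≠ 0 := fun h => hz0 ((ZMod.val_eq_zero z).1 h)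
    have : c < 2 := by nlinarith
    interval_cases c
    · omega
    · omega
  apply ZMod.val_injective l
  have := key x hx hx0
  have := key y hy hy0
  omega

theorem card_inter_sub (A : Finset (ZMod l)) (g : ZMod l) :
    2 * A.card ≤ l + (A ∩ A.image (g - ·)).card := by
  have h1 := Finset.card_union_add_card_inter A (A.image (g - ·))
  rw [Finset.card_image_of_injective _ sub_right_injective] at h1
  have h2 := (A ∪ A.image (g - ·)).card_le_univ
  rw [ZMod.card] at h2
  omega

theorem add_eq_univ_of_lt (h : l < 2 * A.card) : A + A = Finset.univ := by
  rw [Finset.eq_univ_iff_forall]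
  intro g
  have h1 := card_inter_sub A g
  obtain ⟨x, hx⟩ := Finset.card_pos.1 (by omega : 0 < (A ∩ A.image (g - ·)).card)
  obtain ⟨hx, hx'⟩ := Finset.mem_inter.1 hx
  obtain ⟨y, hy, rfl⟩ := Finset.mem_image.1 hx'
  simpa using Finset.add_mem_add hx hy

theorem distinctSums_eq_univ_of_lt (h : l + 2 < 2 * A.card) : distinctSums A = Finset.univ := by
  rw [Finset.eq_univ_iff_forall]
  intro g
  have h1 := card_inter_sub A g
  have h2 : ∃ x ∈ A ∩ A.image (g - ·), x + x ≠ g := by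
    by_contra! hall
    have := card_le_two_of_double_eq ZMod.eq_of_add_self_eq_zero hall
    omega
  obtain ⟨x, hx, hne⟩ := h2
  obtain ⟨hx, hx'⟩ := Finset.mem_inter.1 hx
  obtain ⟨y, hy, rfl⟩ := Finset.mem_image.1 hx'
  have := add_mem_distinctSums hx hy fun h => hne (by nth_rw 1 [h]; abel)
  simpa using this

theorem le_card_lift_add_of_lt (h0 : 0 ∈ A) (h : l < 2 * A.card) :
    l + A.card + 1 ≤ (lift A + lift A).card := by
  have := card_add_add_card_lt h0
  rwa [add_eq_univ_of_lt h, Finset.card_univ, ZMod.card] at this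

theorem le_card_distinctSums_lift_of_lt (h0 : 0 ∈ A) (h : l + 2 < 2 * A.card) :
    l + A.card ≤ (distinctSums (lift A)).card := by
  have := card_distinctSums_add_card_le h0
  rwa [distinctSums_eq_univ_of_lt h, Finset.card_univ, ZMod.card] at this

section Classes

variable {Q : Type*} [AddCommGroup Q] [DecidableEq Q]

theorem card_fiber_add_card_fiber_le (π : ZMod l →+ Q) {c c' : Q} (hc : (fiber π A c).Nonempty)
    (hc' : (fiber π A c').Nonempty) : (fiber π A c).card + (fiber π A c').card ≤
      ((lift A + lift A).filter fun t : ℤ => π (t : ZMod l) = c + c').card + 1 := by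
  have h := cauchy_davenport_add_of_linearOrder_isCancelAdd
    (hc.image fun x : ZMod l => (x.val : ℤ)) (hc'.image fun x : ZMod l => (x.val : ℤ))
  rw [Finset.card_image_of_injective _ val_int_injective,
    Finset.card_image_of_injective _ val_int_injective] at h
  have h2 : (fiber π A c).image (fun x : ZMod l => (x.val : ℤ)) +
      (fiber π A c').image (fun x : ZMod l => (x.val : ℤ)) ⊆
      (lift A + lift A).filter fun t : ℤ => π (t : ZMod l) = c + c' := by
    intro t ht
    obtain ⟨_, hx, _, hy, rfl⟩ := Finset.mem_add.1 ht
    obtain ⟨x, hxc, rfl⟩ := Finset.mem_image.1 hx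
    obtain ⟨y, hyc, rfl⟩ := Finset.mem_image.1 hy
    rw [mem_fiber] at hxc hyc
    rw [Finset.mem_filter]
    refine ⟨Finset.add_mem_add (val_mem_lift hxc.1) (val_mem_lift hyc.1), ?_⟩
    simp [hxc.2, hyc.2]
  have := Finset.card_le_card h2
  omega

theorem two_mul_card_le_card_distinctSums {X : Finset ℤ} {S : Finset ℤ}
    (h : ∀ x ∈ X, ∀ y ∈ X, x ≠ y → x + y ∈ S) : 2 * X.card ≤ S.card + 3 := by
  rcases X.eq_empty_or_nonempty with rfl | hX
  · simp
  set a := X.min' hX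
  set b := X.max' hX
  have hsub : (X.erase a).image (a + ·) ∪ (X.erase b).image (b + ·) ⊆ S := by
    intro t ht
    rcases Finset.mem_union.1 ht with ht | ht <;> obtain ⟨x, hx, rfl⟩ := Finset.mem_image.1 ht <;>
      rw [Finset.mem_erase] at hx
    · exact h _ (X.min'_mem hX) _ hx.2 hx.1.symm
    · exact h _ (X.max'_mem hX) _ hx.2 hx.1.symm
  have hint : (X.erase a).image (a + ·) ∩ (X.erase b).image (b + ·) ⊆ {a + b} := by
    intro t ht
    obtain ⟨h1, h2⟩ := Finset.mem_inter.1 ht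
    obtain ⟨x, hx, rfl⟩ := Finset.mem_image.1 h1
    obtain ⟨y, hy, hxy⟩ := Finset.mem_image.1 h2
    have h3 : x ≤ b := X.le_max' x (Finset.mem_of_mem_erase hx)
    have h4 : a ≤ y := X.min'_le y (Finset.mem_of_mem_erase hy)
    rw [Finset.mem_singleton]
    omega
  have h1 := Finset.card_union_add_card_inter ((X.erase a).image (a + ·))
    ((X.erase b).image (b + ·))
  rw [Finset.card_image_of_injective _ (add_right_injective a),
    Finset.card_image_of_injective _ (add_right_injective b),
    Finset.card_erase_of_mem (X.min'_mem hX), Finset.card_erase_of_mem (X.max'_mem hX)] at h1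
  have h2 := Finset.card_le_card hsub
  have h3 := Finset.card_le_card hint
  rw [Finset.card_singleton] at h3
  omega

/-- The part of the sumset lying over the cosets met by `A`. -/
theorem card_add_card_lt_of_subset_add (h0 : 0 ∈ A) (π : ZMod l →+ Q) {X : Finset (ZMod l)}
    (hAX : A ⊆ X) (hX : X ⊆ A + A) (hπ : ∀ x ∈ X, π x ∈ A.image π) :
    X.card + A.card + 1 ≤
      ((lift A + lift A).filter fun t : ℤ => π (t : ZMod l) ∈ A.image π).card := by
  have hmem : (2 * l : ℤ) ∈
      (lift A + lift A).filter fun t : ℤ => π (t : ZMod l) ∈ A.image π := by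
    refine Finset.mem_filter.2 ⟨two_mul_mem_lift_add, ?_⟩
    simpa using ⟨0, h0, map_zero π⟩
  rw [← Finset.card_erase_add_one hmem, Nat.add_le_add_iff_right]
  refine card_add_card_le_of_cover (NeZero.ne l) hAX (fun x hx => ?_) (fun x hx => ?_)
  · obtain ⟨t, ht, rfl⟩ := exists_lift_add (hX hx)
    rw [Finset.mem_erase] at ht
    exact ⟨t, Finset.mem_erase.2 ⟨ht.1, Finset.mem_filter.2 ⟨ht.2, hπ _ hx⟩⟩, rfl⟩
  · obtain ⟨t, ht, ht', rfl⟩ := exists_double_lift_add h0 hx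
    rw [Finset.mem_erase] at ht ht'
    refine ⟨t, Finset.mem_erase.2 ⟨ht.1, Finset.mem_filter.2 ⟨ht.2, hπ _ (hAX hx)⟩⟩,
      Finset.mem_erase.2 ⟨ht'.1, Finset.mem_filter.2 ⟨ht'.2, ?_⟩⟩, rfl⟩
    simpa using hπ _ (hAX hx)

end Classes

theorem three_mul_card_le_of_quotient (h0 : 0 ∈ A) {Q : Type*} [AddCommGroup Q] [DecidableEq Q]
    {π : ZMod l →+ Q} {q : ℕ} (hq : ∀ c, (fiber π Finset.univ c).card = q)
    (hu : 2 ≤ (A.image π).card) (hA : (A.image π).card * q + 2 ≤ A.card + q)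
    (hC : 2 * (A.image π).card ≤ (A.image π + A.image π).card + 1) :
    3 * A.card ≤ (lift A + lift A).card := by
  set C := A.image π with hCdef
  have hmemC : ∀ x ∈ A, π x ∈ C := fun x hx => Finset.mem_image_of_mem _ hx
  have h0C : (0 : Q) ∈ C := by simpa using hmemC 0 h0
  have hfne : ∀ c ∈ C, (fiber π A c).Nonempty := by
    intro c hc
    obtain ⟨x, hx, rfl⟩ := Finset.mem_image.1 hc
    exact ⟨x, mem_fiber.2 ⟨hx, rfl⟩⟩
  obtain ⟨v, hv⟩ : ∃ v, C.card = v + 1 := ⟨C.card - 1, by omega⟩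
  have hmC : A.card ≤ C.card * q := by
    have := sum_holes hq A
    rw [← hCdef] at this
    omega
  obtain ⟨D, hD⟩ : ∃ D, A.card = D + v * q :=
    ⟨A.card - v * q, by rw [hv, Nat.succ_mul] at hA; omega⟩
  have hCq : C.card * q = v * q + q := by rw [hv, Nat.succ_mul]
  have hD2 : 2 ≤ D := by omega
  have hDq : D ≤ q := by omega
  have hlow : ∀ c ∈ C, D ≤ (fiber π A c).card := by
    intro c hc
    have h1 := sum_holes hq A
    have h2 := Finset.single_le_sum (f := fun c => q - (fiber π A c).card)
      (fun _ _ => Nat.zero_le _) hc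
    simp only [← hCdef] at h1 h2
    omega
  have hpair : ∀ c ∈ C, ∀ c' ∈ C, c ≠ c' →
      q + D ≤ (fiber π A c).card + (fiber π A c').card := by
    intro c hc c' hc' hne
    have := holes_add_holes_le_s13 hq hc hc' hne
    rw [← hCdef] at this
    omega
  obtain ⟨c₀, -, hexc⟩ := exists_exceptional_fiber hq ⟨0, h0⟩
  rw [← hCdef] at hexc
  have hsingle : ∀ c ∈ C, c ≠ c₀ → q + D ≤ 2 * (fiber π A c).card := by
    intro c hc hne
    have := hexc c hc hne
    omega
  set N := (C + C) \ C with hN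
  have hNcard : v ≤ N.card := by
    have hsub : C ⊆ C + C := fun c hc => by simpa using Finset.add_mem_add hc h0C
    rw [hN, Finset.card_sdiff_of_subset hsub]
    omega
  have htotal := card_filter_add_sum_card_filter_le (lift A + lift A)
    (fun t : ℤ => π (t : ZMod l)) (Finset.disjoint_sdiff : Disjoint C N)
  rw [← hN] at htotal
  have hnew : ∀ c ∈ N, ∃ c₁ ∈ C, ∃ c₂ ∈ C, c₁ ≠ 0 ∧ c₂ ≠ 0 ∧ c₁ + c₂ = c ∧
      (fiber π A c₁).card + (fiber π A c₂).card ≤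
        ((lift A + lift A).filter fun t : ℤ => π (t : ZMod l) = c).card + 1 := by
    intro c hc
    obtain ⟨hc, hcC⟩ := Finset.mem_sdiff.1 hc
    obtain ⟨c₁, h1, c₂, h2, rfl⟩ := Finset.mem_add.1 hc
    refine ⟨c₁, h1, c₂, h2, ?_, ?_, rfl,
      card_fiber_add_card_fiber_le π (hfne _ h1) (hfne _ h2)⟩
    · rintro rfl
      exact hcC (by simpa using h2)
    · rintro rfl
      exact hcC (by simpa using h1)
  have hcover : ∀ x : ZMod l, π x ∈ C → (π x = 0 → c₀ ≠ 0) → x ∈ A + A := by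
    intro x hx hx0
    have hlt : q < (fiber π A (π x)).card + (fiber π A 0).card := by
      by_cases h : π x = 0
      · have := hsingle 0 h0C (hx0 h).symm
        rw [h]
        omega
      · have := hpair _ hx _ h0C h
        omega
    obtain ⟨a, ha, b, hb, -, -, rfl⟩ :=
      exists_add_eq_of_lt_card_fiber hq hlt (add_zero (π x)).symm
    exact Finset.add_mem_add ha hb
  have hAA : A ⊆ A + A := fun x hx => by simpa using Finset.add_mem_add hx h0
  by_cases hc₀ : c₀ = 0
  · have hold := card_add_card_lt_of_subset_add h0 π
      (X := (Finset.univ.filter fun x => π x ∈ C.erase 0) ∪ fiber π A 0)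
      (by
        intro x hx
        by_cases h : π x = 0
        · exact Finset.mem_union_right _ (mem_fiber.2 ⟨hx, h⟩)
        · exact Finset.mem_union_left _ (by simp [h, hmemC x hx]))
      (by
        refine Finset.union_subset (fun x hx => ?_) fun x hx => hAA (mem_fiber.1 hx).1
        simp only [Finset.mem_filter, Finset.mem_univ, true_and, Finset.mem_erase] at hx
        exact hcover x hx.2 fun h => absurd h hx.1)
      (by
        intro x hx
        rcases Finset.mem_union.1 hx with hx | hx
        · exact Finset.mem_of_mem_erase (Finset.mem_filter.1 hx).2
        · exact hmemC x (mem_fiber.1 hx).1)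
    rw [Finset.card_union_of_disjoint (by
      rw [Finset.disjoint_left]
      intro x hx hx'
      exact Finset.ne_of_mem_erase (Finset.mem_filter.1 hx).2 (mem_fiber.1 hx').2),
      card_preimage hq, Finset.card_erase_of_mem h0C, hv, Nat.add_sub_cancel] at hold
    have hsum : v * (q + D - 1) ≤
        ∑ c ∈ N, ((lift A + lift A).filter fun t : ℤ => π (t : ZMod l) = c).card := by
      refine (Nat.mul_le_mul_right _ hNcard).trans ?_
      rw [← smul_eq_mul]
      refine Finset.card_nsmul_le_sum _ _ _ fun c hc => ?_
      obtain ⟨c₁, h1, c₂, h2, h1', h2', -, hle⟩ := hnew c hc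
      by_cases h : c₁ = c₂
      · have := hsingle c₁ h1 (hc₀ ▸ h1')
        subst h
        omega
      · have := hpair _ h1 _ h2 h
        omega
    have h00 := hlow 0 h0C
    rw [← hCdef] at hold
    obtain ⟨w, rfl⟩ : ∃ w, v = w + 1 := ⟨v - 1, by omega⟩
    obtain ⟨E, rfl⟩ : ∃ E, D = E + 1 := ⟨D - 1, by omega⟩
    have : (w + 1) * (q + (E + 1) - 1) = (w + 1) * q + w * E + E := by
      rw [show q + (E + 1) - 1 = q + E by omega]; ring
    have : 0 ≤ w * E := Nat.zero_le _
    omega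
  · have hold := card_add_card_lt_of_subset_add h0 π
      (X := Finset.univ.filter fun x => π x ∈ C)
      (fun x hx => by simp [hmemC x hx])
      (fun x hx => hcover x (Finset.mem_filter.1 hx).2 fun _ => hc₀)
      (fun x hx => (Finset.mem_filter.1 hx).2)
    rw [card_preimage hq, hCq] at hold
    have hsum : v * (q + D - 1) ≤
        ∑ c ∈ N, ((lift A + lift A).filter fun t : ℤ => π (t : ZMod l) = c).card + (q - D) := by
      refine (Nat.mul_le_mul_right _ hNcard).trans ?_
      have h1 : N.card * (q + D - 1) ≤ ∑ c ∈ N,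
          (((lift A + lift A).filter fun t : ℤ => π (t : ZMod l) = c).card +
            if c = c₀ + c₀ then q - D else 0) := by
        rw [← smul_eq_mul]
        refine Finset.card_nsmul_le_sum _ _ _ fun c hc => ?_
        obtain ⟨c₁, h1, c₂, h2, h1', h2', hcc, hle⟩ := hnew c hc
        by_cases h : c₁ = c₂
        · subst h
          by_cases h' : c₁ = c₀
          · subst h'
            have := hlow c₁ h1
            rw [if_pos hcc.symm]
            omega
          · have := hsingle c₁ h1 h'
            omega
        · have := hpair _ h1 _ h2 h
          omega
      rw [Finset.sum_add_distrib, Finset.sum_ite_eq'] at h1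
      refine h1.trans (Nat.add_le_add_left ?_ _)
      split_ifs <;> omega
    rw [← hCdef] at hold
    obtain ⟨w, rfl⟩ : ∃ w, v = w + 1 := ⟨v - 1, by omega⟩
    obtain ⟨E, rfl⟩ : ∃ E, D = E + 1 := ⟨D - 1, by omega⟩
    have : (w + 1) * (q + (E + 1) - 1) = (w + 1) * q + w * E + E := by
      rw [show q + (E + 1) - 1 = q + E by omega]; ring
    have : 0 ≤ w * E := Nat.zero_le _
    omega

theorem three_mul_card_le_card_lift_add (h0 : 0 ∈ A)
    (hgen : ∀ H : AddSubgroup (ZMod l), (∀ x ∈ A, x ∈ H) → H = ⊤) (hl : 2 * A.card ≤ l) :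
    3 * A.card ≤ (lift A + lift A).card := by
  have h1 := card_add_add_card_lt h0
  by_cases hu : A + A = Finset.univ
  · rw [hu, Finset.card_univ, ZMod.card] at h1
    omega
  by_cases hcard : (A + A).card + 2 ≤ 2 * A.card
  · obtain ⟨Q, _, _, π, q, -, hq, hu2, hA, hC⟩ :=
      exists_quotient_of_card_add_lt h0 hgen hu hcard
    exact three_mul_card_le_of_quotient h0 hq hu2 (by omega) hC
  · omega

theorem theta_bounds : theta ^ 2 = theta + 1 ∧ 1.6 < theta ∧ theta < 1.62 := by
  have h5 : Real.sqrt 5 ^ 2 = 5 := Real.sq_sqrt (by norm_num)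
  have h0 := Real.sqrt_nonneg 5
  refine ⟨?_, ?_, ?_⟩
  · rw [theta]
    linear_combination h5 / 4
  · rw [theta]
    have : 2.2 < Real.sqrt 5 := Real.lt_sqrt_of_sq_lt (by norm_num)
    linarith
  · rw [theta]
    have : Real.sqrt 5 < 2.24 := (Real.sqrt_lt' (by norm_num)).2 (by norm_num)
    linarith

/-- The case in which the residues of `A` meet two cosets of a subgroup of order `q`. -/
theorem three_mul_card_le_of_two_cosets (h0 : 0 ∈ A) {Q : Type*} [AddCommGroup Q] [DecidableEq Q]
    {π : ZMod l →+ Q} {q : ℕ} (hq : ∀ c, (fiber π Finset.univ c).card = q)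
    (hu : (A.image π).card = 2) (hA : 3 * q < 2 * A.card)
    (hC : 3 ≤ (A.image π + A.image π).card) (hAA : A + A ⊆ distinctSums A) :
    3 * A.card ≤ (distinctSums (lift A)).card + 3 := by
  set C := A.image π with hCdef
  have h0C : (0 : Q) ∈ C := map_zero π ▸ Finset.mem_image_of_mem π h0
  obtain ⟨d, hd, hd0⟩ := Finset.exists_mem_ne (by omega : 1 < C.card) 0
  have hCeq : C = {0, d} := by
    refine (Finset.eq_of_subset_of_card_le ?_ ?_).symm
    · intro x hx
      simp only [Finset.mem_insert, Finset.mem_singleton] at hx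
      rcases hx with rfl | rfl <;> assumption
    · rw [hu, Finset.card_pair hd0.symm]
  have hsum : (fiber π A 0).card + (fiber π A d).card = A.card := by
    rw [← sum_card_fiber π A, ← hCdef, hCeq, Finset.sum_pair hd0.symm]
  have hle0 := card_fiber_le hq A 0
  have hled := card_fiber_le hq A d
  have hdd : d + d ∉ C := by
    intro h
    have hsub : C + C ⊆ C := by
      intro x hx
      obtain ⟨y, hy, z, hz, rfl⟩ := Finset.mem_add.1 hx
      rw [hCeq, Finset.mem_insert, Finset.mem_singleton] at hy hz
      rcases hy with rfl | rfl
      · rcases hz with rfl | rfl <;> simpa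
      · rcases hz with rfl | rfl <;> simpa
    have := Finset.card_le_card hsub
    omega
  have htotal := card_filter_add_sum_card_filter_le (distinctSums (lift A))
    (fun t : ℤ => π (t : ZMod l)) (Finset.disjoint_singleton_right.2 hdd)
  rw [Finset.sum_singleton] at htotal
  have hcover : ∀ x : ZMod l, π x ∈ C → x ∈ distinctSums A := by
    intro x hx
    have hlt : q < (fiber π A (π x)).card + (fiber π A 0).card := by
      rw [hCeq, Finset.mem_insert, Finset.mem_singleton] at hx
      rcases hx with h | h <;> rw [h] <;> omega
    obtain ⟨a, ha, b, hb, -, -, rfl⟩ :=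
      exists_add_eq_of_lt_card_fiber hq hlt (add_zero (π x)).symm
    exact hAA (Finset.add_mem_add ha hb)
  have hold : C.card * q + A.card ≤
      ((distinctSums (lift A)).filter fun t : ℤ => π (t : ZMod l) ∈ C).card := by
    rw [← card_preimage hq]
    have hmem : ∀ x ∈ A, π x ∈ C := fun x hx => Finset.mem_image_of_mem _ hx
    refine card_add_card_le_of_cover (NeZero.ne l) (fun x hx => by simp [hmem x hx])
      (fun x hx => ?_) (fun x hx => ?_)
    · have hx := (Finset.mem_filter.1 hx).2
      obtain ⟨t, ht, rfl⟩ := exists_distinctSums_lift (hcover x hx)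
      exact ⟨t, Finset.mem_filter.2 ⟨ht, hx⟩, rfl⟩
    · obtain ⟨t, ht, ht', rfl⟩ := exists_double_distinctSums_lift h0 hx
      refine ⟨t, Finset.mem_filter.2 ⟨ht, hmem _ hx⟩, Finset.mem_filter.2 ⟨ht', ?_⟩, rfl⟩
      simpa using hmem _ hx
  have hnew := two_mul_card_le_card_distinctSums
    (X := (fiber π A d).image fun x : ZMod l => (x.val : ℤ))
    (S := (distinctSums (lift A)).filter fun t : ℤ => π (t : ZMod l) = d + d) (by
      intro t ht s hs hts
      obtain ⟨x, hx, rfl⟩ := Finset.mem_image.1 ht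
      obtain ⟨y, hy, rfl⟩ := Finset.mem_image.1 hs
      rw [mem_fiber] at hx hy
      refine Finset.mem_filter.2
        ⟨add_mem_distinctSums_lift hx.1 hy.1 fun h => hts (by rw [h]), ?_⟩
      simp [hx.2, hy.2])
  rw [Finset.card_image_of_injective _ val_int_injective] at hnew
  rw [hu] at hold
  omega

theorem theta_le_card_distinctSums_lift (h0 : 0 ∈ A)
    (hgen : ∀ H : AddSubgroup (ZMod l), (∀ x ∈ A, x ∈ H) → H = ⊤) (hm : 3 ≤ A.card)
    (hl : 2 * A.card ≤ l + 2) :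
    (theta + 1) * (A.card + 1) - 5 ≤ ((distinctSums (lift A)).card : ℝ) := by
  obtain ⟨hsq, hgt, hlt⟩ := theta_bounds
  have hm' : (3 : ℝ) ≤ A.card := by exact_mod_cast hm
  have h1 : ((distinctSums A).card : ℝ) + A.card ≤ (distinctSums (lift A)).card := by
    exact_mod_cast card_distinctSums_add_card_le h0
  by_contra! hcon
  have hX : ((distinctSums A).card : ℝ) < theta * (A.card + 1) - 4 := by nlinarith
  have hX' : 100 * (distinctSums A).card + 238 < 162 * A.card := by
    have : 100 * ((distinctSums A).card : ℝ) + 238 < 162 * A.card := by nlinarith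
    exact_mod_cast this
  by_cases hlon : (lonely A).Nonempty
  · have h2 := sq_card_le_of_lonely ZMod.eq_of_add_self_eq_zero h0 hlon
    have h3 : (A.card : ℝ) ≤ (distinctSums A).card := by
      exact_mod_cast Finset.card_le_card (subset_distinctSums h0)
    have h2' : (A.card : ℝ) ^ 2 + A.card * (distinctSums A).card ≤
        (distinctSums A).card * ((distinctSums A).card + 3) + 2 := by exact_mod_cast h2
    generalize ((distinctSums A).card : ℝ) = X at *
    generalize (A.card : ℝ) = m at *
    have h4 : X * (X + 3 - m) ≤
        (theta * (m + 1) - 4) * ((theta * (m + 1) - 4) + 3 - m) :=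
      mul_le_mul hX.le (by linarith) (by linarith) (by linarith)
    have h5 : (theta * (m + 1) - 4) * ((theta * (m + 1) - 4) + 3 - m) =
        m ^ 2 + (6 - 4 * theta) * m + (5 - 4 * theta) := by
      linear_combination (m + 1) ^ 2 * hsq
    nlinarith
  · rw [Finset.not_nonempty_iff_eq_empty] at hlon
    have hAA : A + A ⊆ distinctSums A := by
      intro x hx
      obtain ⟨a, ha, b, hb, rfl⟩ := Finset.mem_add.1 hx
      by_cases h : a = b
      · subst h
        by_contra hno
        exact Finset.notMem_empty a (hlon ▸ mem_lonely.2 ⟨ha, hno⟩)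
      · exact add_mem_distinctSums ha hb h
    have heq := hAA.antisymm (distinctSums_subset h0)
    have hu : A + A ≠ Finset.univ := by
      intro hu
      rw [← heq, hu, Finset.card_univ, ZMod.card] at hX'
      omega
    rw [← heq] at hX'
    obtain ⟨Q, _, _, π, q, hqpos, hq, hu2, hA, hC⟩ :=
      exists_quotient_of_card_add_lt h0 hgen hu (by omega)
    have hle : A.card ≤ (A.image π).card * q := by
      have := sum_holes hq A
      omega
    have hcard : (A.image π).card = 2 := by
      by_contra hne
      have : 3 * q ≤ (A.image π).card * q := Nat.mul_le_mul_right q (by omega)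
      omega
    rw [hcard] at hA hC hle
    have := three_mul_card_le_of_two_cosets h0 hq hcard (by omega) (by omega) hAA
    have : 3 * (A.card : ℝ) ≤ (distinctSums (lift A)).card + 3 := by exact_mod_cast this
    nlinarith

end Lift

section SubsequenceSums

theorem card_le_card_seqSubAlpha {M : Multiset ℤ} {T : Finset ℤ}
    (h : ∀ t ∈ T, ∃ B ≤ M, Multiset.card B ≤ 2 ∧ B.sum = t) :
    T.card ≤ (SeqSubAlpha (Multiset.card M - 2) M).card := by
  rw [← Finset.card_image_of_injective T (sub_right_injective (b := M.sum))]
  refine Finset.card_le_card fun s hs => ?_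
  obtain ⟨t, ht, rfl⟩ := Finset.mem_image.1 hs
  obtain ⟨B, hB, hcard, rfl⟩ := h t ht
  rw [SeqSubAlpha, Multiset.mem_toFinset, Multiset.mem_map]
  refine ⟨M - B, ?_, ?_⟩
  · rw [Multiset.mem_filter, Multiset.mem_powerset, Multiset.card_sub hB]
    exact ⟨Multiset.sub_le_self M B, by omega⟩
  · rw [eq_sub_iff_add_eq, ← Multiset.sum_add, Multiset.sub_add_cancel hB]

theorem pair_le_of_mem {M : Multiset ℤ} {x y : ℤ} (hx : x ∈ M) (hy : y ∈ M) (hxy : x ≠ y) :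
    {x, y} ≤ M := by
  rw [Multiset.le_iff_subset (by simpa using hxy)]
  intro z hz
  simp only [Multiset.insert_eq_cons, Multiset.mem_cons, Multiset.mem_singleton] at hz
  rcases hz with rfl | rfl <;> assumption

theorem card_distinctSums_le_card_seqSubAlpha {M : Multiset ℤ} {X : Finset ℤ}
    (hX : ∀ x ∈ X, x ∈ M) :
    (distinctSums X).card ≤ (SeqSubAlpha (Multiset.card M - 2) M).card := by
  refine card_le_card_seqSubAlpha fun t ht => ?_
  rw [distinctSums, Finset.mem_insert, Finset.mem_image] at ht
  rcases ht with rfl | ⟨⟨x, y⟩, hxy, rfl⟩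
  · exact ⟨0, Multiset.zero_le _, by simp, by simp⟩
  · simp only [Finset.mem_filter, Finset.mem_product] at hxy
    exact ⟨{x, y}, pair_le_of_mem (hX x hxy.1.1) (hX y hxy.1.2) hxy.2, by simp, by simp⟩

theorem card_add_le_card_seqSubAlpha {M : Multiset ℤ} {X : Finset ℤ}
    (hX : ∀ x ∈ X, x ∈ M) (hX2 : ∀ x ∈ X, x ≠ 0 → 2 ≤ M.count x) :
    (X + X).card ≤ (SeqSubAlpha (Multiset.card M - 2) M).card := by
  refine card_le_card_seqSubAlpha fun t ht => ?_
  obtain ⟨x, hx, y, hy, rfl⟩ := Finset.mem_add.1 ht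
  by_cases hxy : x = y
  · subst hxy
    by_cases h0 : x = 0
    · exact ⟨0, Multiset.zero_le _, by simp, by simp [h0]⟩
    · exact ⟨Multiset.replicate 2 x, Multiset.le_count_iff_replicate_le.1 (hX2 x hx h0),
        by simp, by simp⟩
  · exact ⟨{x, y}, pair_le_of_mem (hX x hx) (hX y hy) hxy, by simp, by simp⟩

theorem le_count_sum_replicate {ι : Type*} {s : Finset ι} {i : ι} (hi : i ∈ s) (a : ι → ℤ)
    (r : ι → ℕ) : r i ≤ (∑ j ∈ s, Multiset.replicate (r j) (a j)).count (a i) := by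
  rw [Multiset.le_count_iff_replicate_le]
  exact Finset.single_le_sum (f := fun j => Multiset.replicate (r j) (a j))
    (fun _ _ => Multiset.zero_le _) hi

theorem eq_top_of_gcd_eq_one {ι : Type*} {s : Finset ι} {a : ι → ℤ} (h : s.gcd a = 1) {l : ℕ}
    [NeZero l] {H : AddSubgroup (ZMod l)} (hH : ∀ i ∈ s, (a i : ZMod l) ∈ H) : H = ⊤ := by
  obtain ⟨g, hg⟩ := Int.subgroup_cyclic (H.comap (Int.castAddHom (ZMod l)))
  have hmem : ∀ z : ℤ, (z : ZMod l) ∈ H ↔ g ∣ z := by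
    intro z
    rw [← Int.mem_zmultiples_iff, AddSubgroup.zmultiples_eq_closure, ← hg]
    simp
  have h1 : g ∣ 1 := h ▸ Finset.dvd_gcd fun i hi => (hmem _).1 (hH i hi)
  rw [eq_top_iff]
  intro x _
  rw [← intCast_val x, hmem]
  exact h1.trans (one_dvd _)

theorem exists_residues {k : ℕ} (hk : 4 ≤ k) {a : ℕ → ℤ} (h0 : a 0 = 0)
    (ha : ∀ i j, i < j → j ≤ k - 1 → a i < a j) (hgcd : (Finset.Icc 1 (k - 1)).gcd a = 1) :
    ∃ (l : ℕ) (_ : NeZero l) (A : Finset (ZMod l)), (l : ℤ) = a (k - 1) ∧ 0 ∈ A ∧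
      A.card = k - 1 ∧ (∀ H : AddSubgroup (ZMod l), (∀ x ∈ A, x ∈ H) → H = ⊤) ∧
      lift A = (Finset.range k).image a := by
  have hpos : 0 < a (k - 1) := h0 ▸ ha 0 (k - 1) (by omega) le_rfl
  obtain ⟨l, hl⟩ := Int.eq_ofNat_of_zero_le hpos.le
  have hl0 : NeZero l := ⟨by rintro rfl; simp [hl] at hpos⟩
  have hval : ∀ i ∈ Finset.range (k - 1), ((a i : ZMod l).val : ℤ) = a i := by
    intro i hi
    rw [Finset.mem_range] at hi
    rw [ZMod.val_intCast]
    have h1 := ha i (k - 1) hi le_rfl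
    refine Int.emod_eq_of_lt ?_ (by omega)
    rcases Nat.eq_zero_or_pos i with rfl | h
    · omega
    · have := ha 0 i h (by omega)
      omega
  refine ⟨l, hl0, (Finset.range (k - 1)).image fun i => (a i : ZMod l), hl.symm, ?_, ?_, ?_, ?_⟩
  · exact Finset.mem_image.2 ⟨0, Finset.mem_range.2 (by omega), by simp [h0]⟩
  · rw [Finset.card_image_of_injOn, Finset.card_range]
    intro i hi j hj hij
    have h1 := hval i hi
    simp only at hij
    rw [hij, hval j hj] at h1
    rw [Finset.mem_coe, Finset.mem_range] at hi hj
    by_contra hne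
    rcases Nat.lt_or_gt_of_ne hne with h | h
    · have := ha i j h (by omega)
      omega
    · have := ha j i h (by omega)
      omega
  · intro H hH
    refine eq_top_of_gcd_eq_one hgcd fun i hi => ?_
    rw [Finset.mem_Icc] at hi
    by_cases h : i = k - 1
    · rw [h, hl]
      simp
    · exact hH _ (Finset.mem_image_of_mem _ (Finset.mem_range.2 (by omega)))
  · rw [lift, Finset.image_image, ← hl, show k = k - 1 + 1 by omega, Finset.range_add_one,
      Finset.image_insert, Nat.add_sub_cancel]
    congr 1
    exact Finset.image_congr hval

end SubsequenceSums

theorem freiman_alpha_subsequence_sum_last_zero (k : ℕ) (hk : 4 ≤ k) (a : ℕ → ℤ) (r : ℕ → ℕ)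
    (h0 : a 0 = 0)
    (ha : ∀ i j, i < j → j ≤ k - 1 → a i < a j)
    (hr : ∀ i, i ≤ k - 1 → 1 ≤ r i)
    (hgcd : (Finset.Icc 1 (k - 1)).gcd a = 1)
    (rr : ℕ) (hrr : rr = (Finset.Icc 1 (k - 1)).inf' (Finset.nonempty_Icc.mpr (by omega)) r)
    (α : ℕ) (hα : α = (∑ i ∈ Finset.range k, r i) - 2) :
    (rr = 1 →
      (a (k - 1) ≤ 2 * (k : ℤ) - 5 →
        a (k - 1) + (k : ℤ) - 1
          ≤ ((SeqSubAlpha α (∑ i ∈ Finset.range k, Multiset.replicate (r i) (a i))).card : ℤ)) ∧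
      (2 * (k : ℤ) - 4 ≤ a (k - 1) →
        (theta + 1) * (k : ℝ) - 5
          ≤ ((SeqSubAlpha α (∑ i ∈ Finset.range k, Multiset.replicate (r i) (a i))).card : ℝ))) ∧
    (2 ≤ rr →
      (a (k - 1) ≤ 2 * (k : ℤ) - 3 →
        a (k - 1) + (k : ℤ)
          ≤ ((SeqSubAlpha α (∑ i ∈ Finset.range k, Multiset.replicate (r i) (a i))).card : ℤ)) ∧
      (2 * (k : ℤ) - 2 ≤ a (k - 1) →
        3 * k - 3 ≤ (SeqSubAlpha α (∑ i ∈ Finset.range k, Multiset.replicate (r i) (a i))).card)) := by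
  obtain ⟨l, _, A, hl, h0A, hcard, hgen, hlift⟩ := exists_residues hk h0 ha hgcd
  have hMcard : Multiset.card (∑ i ∈ Finset.range k, Multiset.replicate (r i) (a i)) =
      ∑ i ∈ Finset.range k, r i := by simp
  rw [hα, ← hMcard, ← hl]
  have hmem : ∀ x ∈ lift A, x ∈ ∑ i ∈ Finset.range k, Multiset.replicate (r i) (a i) := by
    intro x hx
    rw [hlift] at hx
    obtain ⟨i, hi, rfl⟩ := Finset.mem_image.1 hx
    have h1 := hr i (by rw [Finset.mem_range] at hi; omega)
    exact Multiset.count_pos.1 (h1.trans (le_count_sum_replicate hi a r))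
  refine ⟨fun _ => ?_, fun hrr2 => ?_⟩
  · have hR := card_distinctSums_le_card_seqSubAlpha hmem
    refine ⟨fun hle => ?_, fun hge => ?_⟩
    · have := le_card_distinctSums_lift_of_lt h0A (by omega)
      omega
    · have h1 := theta_le_card_distinctSums_lift h0A hgen (by omega) (by omega)
      rw [hcard, Nat.cast_sub (by omega), Nat.cast_one, sub_add_cancel] at h1
      exact h1.trans (by exact_mod_cast hR)
  · have hT := card_add_le_card_seqSubAlpha hmem (by
      intro x hx hx0
      rw [hlift] at hx
      obtain ⟨i, hi, rfl⟩ := Finset.mem_image.1 hx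
      refine le_trans ?_ (le_count_sum_replicate hi a r)
      have hi1 : i ≠ 0 := fun h => hx0 (h ▸ h0)
      rw [Finset.mem_range] at hi
      exact (hrr ▸ hrr2).trans (Finset.inf'_le r (Finset.mem_Icc.2 (by omega))))
    refine ⟨fun hle => ?_, fun hge => ?_⟩
    · have := le_card_lift_add_of_lt h0A (by omega)
      omega
    · have := three_mul_card_le_card_lift_add h0A hgen (by omega)
      omega
end

section
/- Let 𝔸 be a finite multiset of nonnegative integers with distinct values 0 = a_0 < a_1 < ... < a_{k-1} (k arbitrary), multiplicities r_0, ..., r_{k-1} ≥ 1, gcd(a_1, ..., a_{k-1}) = 1, and min{r_1, ..., r_{k-1}} = 1. If a_{k-1} ≤ 2k - 5, then |S(𝔸)| ≥ a_{k-1} - k + 2 + Σ_{i=1}^{k} (i-1)·r_{i-1}; if a_{k-1} ≥ 2k - 4, then |S(𝔸)| ≥ θk - k - 2 + Σ_{i=1}^{k} (i-1)·r_{i-1}, where θ = (1+√5)/2. -/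
open Pointwise

/-- The set of all sub-multiset sums, the empty one included. -/
def subsetSums (M : Multiset ℤ) : Finset ℤ :=
  (M.powerset.map Multiset.sum).toFinset

theorem mem_subsetSums {M : Multiset ℤ} {t : ℤ} :
    t ∈ subsetSums M ↔ ∃ B ≤ M, B.sum = t := by
  simp [subsetSums]

theorem subsetSums_cons (x : ℤ) (M : Multiset ℤ) :
    subsetSums (x ::ₘ M) = subsetSums M ∪ (subsetSums M).image (· + x) := by
  ext t
  simp only [subsetSums, Multiset.powerset_cons, Multiset.map_add, Multiset.map_map,
    Multiset.mem_toFinset, Multiset.mem_add, Multiset.mem_map, Multiset.mem_powerset,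
    Finset.mem_union, Finset.mem_image, Function.comp_apply, Multiset.sum_cons]
  constructor
  · rintro (h | ⟨B, hB, rfl⟩)
    · exact Or.inl h
    · exact Or.inr ⟨_, ⟨B, hB, rfl⟩, add_comm _ _⟩
  · rintro (h | ⟨_, ⟨B, hB, rfl⟩, rfl⟩)
    · exact Or.inl h
    · exact Or.inr ⟨B, hB, add_comm _ _⟩

theorem mem_subsetSums_of_mem {M : Multiset ℤ} {x : ℤ} (hx : x ∈ M) : x ∈ subsetSums M :=
  mem_subsetSums.2 ⟨{x}, Multiset.singleton_le.2 hx, Multiset.sum_singleton x⟩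

theorem SeqSub_eq_subsetSums {M : Multiset ℤ} (h : (0 : ℤ) ∈ M) : SeqSub M = subsetSums M := by
  ext t
  simp only [SeqSub, mem_subsetSums, Multiset.mem_toFinset, Multiset.mem_map, Multiset.mem_filter,
    Multiset.mem_powerset]
  constructor
  · rintro ⟨B, ⟨hB, -⟩, rfl⟩
    exact ⟨B, hB, rfl⟩
  · rintro ⟨B, hB, rfl⟩
    by_cases h0 : B = 0
    · exact ⟨{0}, ⟨Multiset.singleton_le.2 h, Multiset.singleton_ne_zero 0⟩, by simp [h0]⟩
    · exact ⟨B, ⟨hB, h0⟩, rfl⟩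

/-- Adjoining a translate adds at least one element in every residue class that is met. -/
theorem card_add_card_emod_le (S : Finset ℤ) {x : ℤ} (hx : 0 < x) :
    S.card + (S.image (· % x)).card ≤ (S ∪ S.image (· + x)).card := by
  have hsub : S.image (· % x) ⊆ (S.image (· + x) \ S).image (· % x) := by
    intro c hc
    obtain ⟨s, hs, rfl⟩ := Finset.mem_image.1 hc
    obtain ⟨t, ht, hmax⟩ := (S.filter (fun t => t % x = s % x)).exists_max_image id
      ⟨s, by simp [hs]⟩
    rw [Finset.mem_filter] at ht
    refine Finset.mem_image.2 ⟨t + x, Finset.mem_sdiff.2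
      ⟨Finset.mem_image_of_mem _ ht.1, fun hmem => ?_⟩, by simp [ht.2]⟩
    have := hmax (t + x) (Finset.mem_filter.2 ⟨hmem, by simp [ht.2]⟩)
    simp only [id] at this
    linarith
  have h1 := (Finset.card_le_card hsub).trans Finset.card_image_le
  rw [← Finset.union_sdiff_self_eq_union, Finset.card_union_of_disjoint Finset.disjoint_sdiff]
  omega

theorem card_subsetSums_cons (M : Multiset ℤ) {x : ℤ} (hx : 0 < x) :
    (subsetSums M).card + ((subsetSums M).image (· % x)).card ≤
      (subsetSums (x ::ₘ M)).card := by
  rw [subsetSums_cons]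
  exact card_add_card_emod_le _ hx

/-- Increasing terms up to index `n`, starting from `0`. -/
def IncreasingUpTo (a : ℕ → ℤ) (n : ℕ) : Prop :=
  a 0 = 0 ∧ ∀ i j, i < j → j ≤ n → a i < a j

namespace IncreasingUpTo

variable {a : ℕ → ℤ} {n : ℕ}

theorem mono (h : IncreasingUpTo a n) {m : ℕ} (hm : m ≤ n) : IncreasingUpTo a m :=
  ⟨h.1, fun i j hij hj => h.2 i j hij (hj.trans hm)⟩

theorem le (h : IncreasingUpTo a n) {i j : ℕ} (hij : i ≤ j) (hj : j ≤ n) : a i ≤ a j := by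
  rcases hij.eq_or_lt with rfl | hlt
  · rfl
  · exact (h.2 i j hlt hj).le

theorem lt_of_lt (h : IncreasingUpTo a n) {i j : ℕ} (hi : i ≤ n) (hij : a i < a j) : i < j := by
  by_contra! hc
  exact absurd (h.le hc hi) (not_le.2 hij)

theorem nonneg (h : IncreasingUpTo a n) {i : ℕ} (hi : i ≤ n) : 0 ≤ a i :=
  h.1 ▸ h.le (Nat.zero_le i) hi

theorem injOn (h : IncreasingUpTo a n) : Set.InjOn a (Finset.range (n + 1)) := by
  intro i hi j hj hij
  simp only [Finset.coe_range, Set.mem_Iio] at hi hj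
  rcases lt_trichotomy i j with hlt | heq | hgt
  · exact absurd hij (h.2 i j hlt (by omega)).ne
  · exact heq
  · exact absurd hij (h.2 j i hgt (by omega)).ne'

theorem card_image (h : IncreasingUpTo a n) : ((Finset.range (n + 1)).image a).card = n + 1 := by
  rw [Finset.card_image_of_injOn h.injOn, Finset.card_range]

theorem index_le (h : IncreasingUpTo a n) {i : ℕ} (hi : i ≤ n) : (i : ℤ) ≤ a i := by
  induction i with
  | zero => simp [h.1]
  | succ i ih =>
    have := h.2 i (i + 1) (by omega) hi
    have := ih (by omega)
    push_cast
    omega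

/-- The residues of the earlier terms modulo `a (n + 1)` are the terms themselves. -/
theorem image_subset_image_emod (h : IncreasingUpTo a (n + 1)) {S : Finset ℤ}
    (hS : ∀ i ≤ n, a i ∈ S) :
    (Finset.range (n + 1)).image a ⊆ S.image (· % a (n + 1)) := by
  intro t ht
  obtain ⟨i, hi, rfl⟩ := Finset.mem_image.1 ht
  rw [Finset.mem_range] at hi
  exact Finset.mem_image.2 ⟨a i, hS i (by omega),
    Int.emod_eq_of_lt (h.nonneg (by omega)) (h.2 i (n + 1) hi le_rfl)⟩

theorem card_image_emod (h : IncreasingUpTo a (n + 1)) {S : Finset ℤ}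
    (hS : ∀ i ≤ n, a i ∈ S) : n + 1 ≤ (S.image (· % a (n + 1))).card := by
  simpa only [(h.mono n.le_succ).card_image] using
    Finset.card_le_card (h.image_subset_image_emod hS)

end IncreasingUpTo

/-- Sums of subfamilies of `a 0, ..., a n`. -/
def initialSums (a : ℕ → ℤ) (n : ℕ) : Finset ℤ :=
  subsetSums ((Multiset.range (n + 1)).map a)

theorem initialSums_succ (a : ℕ → ℤ) (n : ℕ) :
    initialSums a (n + 1) = initialSums a n ∪ (initialSums a n).image (· + a (n + 1)) := by
  rw [initialSums, Multiset.range_succ, Multiset.map_cons, subsetSums_cons, ← initialSums]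

theorem mem_initialSums (a : ℕ → ℤ) {i n : ℕ} (hi : i ≤ n) : a i ∈ initialSums a n :=
  mem_subsetSums_of_mem (Multiset.mem_map_of_mem a (Multiset.mem_range.2 (by omega)))

theorem add_mem_initialSums (a : ℕ → ℤ) {i j n : ℕ} (hij : i < j) (hj : j ≤ n) :
    a i + a j ∈ initialSums a n := by
  induction n with
  | zero => omega
  | succ n ih =>
    rw [initialSums_succ, Finset.mem_union]
    rcases hj.eq_or_lt with rfl | hlt
    · exact Or.inr (Finset.mem_image_of_mem (· + a (n + 1)) (mem_initialSums a (by omega)))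
    · exact Or.inl (ih (by omega))

theorem dvd_of_mem_initialSums {a : ℕ → ℤ} {n : ℕ} {g : ℤ} (h : ∀ i ≤ n, g ∣ a i) {t : ℤ}
    (ht : t ∈ initialSums a n) : g ∣ t := by
  obtain ⟨B, hB, rfl⟩ := mem_subsetSums.1 ht
  refine Multiset.dvd_sum fun x hx => ?_
  obtain ⟨i, hi, rfl⟩ := Multiset.mem_map.1 (Multiset.mem_of_le hB hx)
  exact h i (by rw [Multiset.mem_range] at hi; omega)

section

variable {a : ℕ → ℤ} {n : ℕ}

theorem card_initialSums_succ (h : IncreasingUpTo a (n + 1)) :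
    (initialSums a n).card + ((initialSums a n).image (· % a (n + 1))).card ≤
      (initialSums a (n + 1)).card := by
  rw [initialSums_succ]
  refine card_add_card_emod_le _ ?_
  have := h.2 0 (n + 1) (by omega) le_rfl
  rwa [h.1] at this

theorem sum_index_lt_card_initialSums (h : IncreasingUpTo a n) :
    (∑ i ∈ Finset.range (n + 1), (i : ℤ)) + 1 ≤ (initialSums a n).card := by
  induction n with
  | zero =>
    have : 0 < (initialSums a 0).card := Finset.card_pos.2 ⟨_, mem_initialSums a le_rfl⟩
    rw [zero_add, Finset.sum_range_one]
    push_cast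
    omega
  | succ n ih =>
    rw [Finset.sum_range_succ]
    have h1 := ih (h.mono n.le_succ)
    have h2 := card_initialSums_succ h
    have h3 := h.card_image_emod (S := initialSums a n) fun i hi => mem_initialSums a hi
    push_cast
    omega

/-- If a new term contributes as little as possible, the terms form an arithmetic progression. -/
theorem eq_mul_of_card_image_emod_le (h : IncreasingUpTo a (n + 1)) (hn : 3 ≤ n)
    (hcard : ((initialSums a n).image (· % a (n + 1))).card ≤ n + 1) :
    ∀ i ≤ n + 1, a i = i * a 1 := by
  have heq : (Finset.range (n + 1)).image a = (initialSums a n).image (· % a (n + 1)) :=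
    Finset.eq_of_subset_of_card_le
      (h.image_subset_image_emod fun i hi => mem_initialSums a hi)
      (by rwa [(h.mono n.le_succ).card_image])
  have hres : ∀ i j, i < j → j ≤ n → ∃ l ≤ n, a l = (a i + a j) % a (n + 1) := by
    intro i j hij hj
    have : (a i + a j) % a (n + 1) ∈ (Finset.range (n + 1)).image a := by
      rw [heq]
      exact Finset.mem_image_of_mem _ (add_mem_initialSums a hij hj)
    obtain ⟨l, hl, hl'⟩ := Finset.mem_image.1 this
    exact ⟨l, by rw [Finset.mem_range] at hl; omega, hl'⟩
  have h0 := h.1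
  have h01 := h.2 0 1 (by omega) (by omega)
  have h12 := h.2 1 2 (by omega) (by omega)
  have h1m := h.2 1 (n + 1) (by omega) le_rfl
  have h2m := h.2 2 (n + 1) (by omega) le_rfl
  have hnm := h.2 n (n + 1) (by omega) le_rfl
  have htop : a 1 + a n = a (n + 1) := by
    obtain ⟨l, hl, hl'⟩ := hres 1 n (by omega) le_rfl
    have hln := h.le hl (by omega)
    have hn0 := h.nonneg (i := n) (by omega)
    rcases lt_trichotomy (a 1 + a n) (a (n + 1)) with hlt | he | hgt
    · rw [Int.emod_eq_of_lt (by omega) hlt] at hl'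
      omega
    · exact he
    · rw [← Int.sub_emod_right, Int.emod_eq_of_lt (by omega) (by omega)] at hl'
      have hl1 := h.lt_of_lt (i := l) (j := 1) (by omega) (by omega)
      obtain rfl : l = 0 := by omega
      omega
  have hstep : ∀ d l, l + d = n → 2 ≤ l → a 1 + a l = a (l + 1) := by
    intro d
    induction d with
    | zero => rintro l rfl -; exact htop
    | succ d ih =>
      intro l hl hl2
      have hnext := ih (l + 1) (by omega) (by omega)
      obtain ⟨f, hf, hf'⟩ := hres 1 l (by omega) (by omega)
      have hll := h.2 l (l + 1) (by omega) (by omega)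
      have hle := h.le (i := l + 1 + 1) (j := n + 1) (by omega) le_rfl
      have hl0 := h.nonneg (i := l) (by omega)
      rw [Int.emod_eq_of_lt (by omega) (by omega)] at hf'
      have hf1 := h.lt_of_lt (i := l) (j := f) (by omega) (by omega)
      have hf2 := h.lt_of_lt (i := f) (j := l + 1 + 1) (by omega) (by omega)
      obtain rfl : f = l + 1 := by omega
      exact hf'.symm
  have h2 : a 2 = 2 * a 1 := by
    obtain ⟨l, hl, hl'⟩ := hres 2 n (by omega) le_rfl
    rw [← Int.sub_emod_right, Int.emod_eq_of_lt (by omega) (by omega)] at hl'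
    have hlt := h.lt_of_lt (i := l) (j := 2) (by omega) (by omega)
    have hgt := h.lt_of_lt (i := 0) (j := l) (by omega) (by omega)
    obtain rfl : l = 1 := by omega
    omega
  intro i
  induction i with
  | zero => intro _; simp [h0]
  | succ i ih =>
    intro hi
    rcases Nat.lt_or_ge i 2 with hlt | hge
    · interval_cases i
      · simp
      · simpa using h2
    · rw [← hstep (n - i) i (by omega) hge, ih (by omega)]
      push_cast
      ring

/-- If `a 0, ..., a n` fill more than half of the residues modulo `a (n + 1)`, every residue is
a sum of two of them. -/
theorem card_image_emod_eq (h : IncreasingUpTo a (n + 1)) (hdense : a (n + 1) ≤ 2 * n - 1) :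
    a (n + 1) ≤ ((initialSums a n).image (· % a (n + 1))).card := by
  set m := a (n + 1)
  have hm0 : 0 < m := by
    have := h.index_le (i := n + 1) le_rfl
    push_cast at this
    omega
  suffices hsub : Finset.Ico 0 m ⊆ (initialSums a n).image (· % m) by
    have := Finset.card_le_card hsub
    rw [Int.card_Ico] at this
    omega
  intro c hc
  rw [Finset.mem_Ico] at hc
  set X := (Finset.range (n + 1)).image a with hX
  have hXm : ∀ y ∈ X, 0 ≤ y ∧ y < m := by
    intro y hy
    obtain ⟨i, hi, rfl⟩ := Finset.mem_image.1 hy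
    rw [Finset.mem_range] at hi
    exact ⟨h.nonneg (by omega), h.2 i (n + 1) hi le_rfl⟩
  have hXcard : X.card = n + 1 := (h.mono n.le_succ).card_image
  set Y := X.image (fun y => (c - y) % m) with hY
  have hYcard : Y.card = n + 1 := by
    rw [hY, Finset.card_image_of_injOn, hXcard]
    intro y hy z hz hyz
    have hy := hXm y hy
    have hz := hXm z hz
    have hd : m ∣ z - y := by
      have := Int.ModEq.dvd (n := m) (a := c - z) (b := c - y) hyz.symm
      simpa using this
    have := Int.eq_zero_of_abs_lt_dvd hd (by rw [abs_lt]; omega)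
    omega
  have hunion : (X ∪ Y).card ≤ m.toNat := by
    have hs : X ∪ Y ⊆ Finset.Ico 0 m := by
      intro y hy
      rw [Finset.mem_Ico]
      rcases Finset.mem_union.1 hy with hy | hy
      · exact hXm y hy
      · obtain ⟨z, -, rfl⟩ := Finset.mem_image.1 hy
        exact ⟨Int.emod_nonneg _ hm0.ne', Int.emod_lt_of_pos _ hm0⟩
    simpa using Finset.card_le_card hs
  have hinter := Finset.card_union_add_card_inter X Y
  have h3 : 2 < (X ∩ Y).card := by omega
  have hrep : ∃ y ∈ X, ∃ z ∈ X, y ≠ z ∧ m ∣ c - (y + z) := by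
    by_contra! hno
    have hdouble : ∀ y ∈ X ∩ Y, m ∣ c - 2 * y := by
      intro y hy
      obtain ⟨hy1, hy2⟩ := Finset.mem_inter.1 hy
      obtain ⟨z, hz, hzy⟩ := Finset.mem_image.1 hy2
      have hd : m ∣ c - (y + z) := by
        have := Int.dvd_self_sub_emod (x := c - z) (m := m)
        rw [hzy] at this
        convert this using 1
        ring
      by_cases hyz : y = z
      · subst hyz
        rwa [two_mul]
      · exact absurd hd (hno y hy1 z hz hyz)
    have key : ∀ y ∈ X ∩ Y, ∀ z ∈ X ∩ Y, y < z → 2 * (z - y) = m := by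
      intro y hy z hz hyz
      have h1 := hXm y (Finset.mem_inter.1 hy).1
      have h2 := hXm z (Finset.mem_inter.1 hz).1
      have hd : m ∣ 2 * (z - y) - m := by
        have := ((hdouble y hy).sub (hdouble z hz)).sub (dvd_refl m)
        rwa [show c - 2 * y - (c - 2 * z) - m = 2 * (z - y) - m by ring] at this
      have := Int.eq_zero_of_abs_lt_dvd hd (by rw [abs_lt]; omega)
      omega
    obtain ⟨y, z, w, hy, hz, hw, hyz, hyw, hzw⟩ := Finset.two_lt_card_iff.1 h3
    have key' : ∀ y ∈ X ∩ Y, ∀ z ∈ X ∩ Y, y ≠ z → 2 * (z - y) = m ∨ 2 * (y - z) = m := by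
      intro y hy z hz hne
      rcases lt_or_gt_of_ne hne with hl | hl
      · exact Or.inl (key y hy z hz hl)
      · exact Or.inr (key z hz y hy hl)
    have e1 := key' y hy z hz hyz
    have e2 := key' y hy w hw hyw
    have e3 := key' z hz w hw hzw
    omega
  obtain ⟨y, hy, z, hz, hyz, hd⟩ := hrep
  have hmem : y + z ∈ initialSums a n := by
    obtain ⟨i, hi, rfl⟩ := Finset.mem_image.1 hy
    obtain ⟨j, hj, rfl⟩ := Finset.mem_image.1 hz
    rw [Finset.mem_range] at hi hj
    rcases lt_trichotomy i j with hlt | rfl | hgt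
    · exact add_mem_initialSums a hlt (by omega)
    · exact absurd rfl hyz
    · rw [add_comm]
      exact add_mem_initialSums a hgt (by omega)
  refine Finset.mem_image.2 ⟨y + z, hmem, ?_⟩
  have : (y + z) % m = c % m := (Int.modEq_iff_dvd (n := m)).2 hd
  simpa [Int.emod_eq_of_lt hc.1 hc.2] using this

/-- An integer in `(a n, 2 * n)` is a sum of two distinct terms among `a 1, ..., a n`. -/
theorem mem_initialSums_of_dense (h : IncreasingUpTo a n) {x : ℤ} (hx : a n < x)
    (hx' : x < 2 * n) : x ∈ initialSums a n := by
  set X := ((Finset.range (n + 1)).image a).erase 0 with hX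
  have hXcard : X.card = n := by
    rw [hX, Finset.card_erase_of_mem, h.card_image, Nat.add_sub_cancel]
    exact Finset.mem_image.2 ⟨0, by simp, h.1⟩
  have hXm : ∀ y ∈ X, 1 ≤ y ∧ y ≤ a n := by
    intro y hy
    obtain ⟨hy0, hy⟩ := Finset.mem_erase.1 hy
    obtain ⟨i, hi, rfl⟩ := Finset.mem_image.1 hy
    rw [Finset.mem_range] at hi
    have := h.nonneg (i := i) (by omega)
    exact ⟨by omega, h.le (by omega) le_rfl⟩
  set Y := X.image (fun y => x - y) with hY
  have hYcard : Y.card = n := by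
    rw [hY, Finset.card_image_of_injective _ (sub_right_injective), hXcard]
  have hunion : (X ∪ Y).card ≤ (x - 1).toNat := by
    have hs : X ∪ Y ⊆ Finset.Ico 1 x := by
      intro y hy
      rw [Finset.mem_Ico]
      rcases Finset.mem_union.1 hy with hy | hy
      · have := hXm y hy
        omega
      · obtain ⟨z, hz, rfl⟩ := Finset.mem_image.1 hy
        have := hXm z hz
        omega
    simpa using Finset.card_le_card hs
  have hinter := Finset.card_union_add_card_inter X Y
  have hn := h.nonneg (i := n) le_rfl
  have hrep : ∃ y ∈ X, ∃ z ∈ X, y ≠ z ∧ y + z = x := by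
    obtain ⟨y, hy, z, hz, hyz⟩ := Finset.one_lt_card.1 (show 1 < (X ∩ Y).card by omega)
    obtain ⟨hy1, hy2⟩ := Finset.mem_inter.1 hy
    obtain ⟨hz1, hz2⟩ := Finset.mem_inter.1 hz
    obtain ⟨y', hy', hyy⟩ := Finset.mem_image.1 hy2
    obtain ⟨z', hz', hzz⟩ := Finset.mem_image.1 hz2
    by_cases hne : y = y'
    · exact ⟨z, hz1, z', hz', by omega, by omega⟩
    · exact ⟨y, hy1, y', hy', hne, by omega⟩
  obtain ⟨y, hy, z, hz, hyz, rfl⟩ := hrep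
  obtain ⟨i, hi, rfl⟩ := Finset.mem_image.1 (Finset.mem_of_mem_erase hy)
  obtain ⟨j, hj, rfl⟩ := Finset.mem_image.1 (Finset.mem_of_mem_erase hz)
  rw [Finset.mem_range] at hi hj
  rcases lt_trichotomy i j with hlt | rfl | hgt
  · exact add_mem_initialSums a hlt (by omega)
  · exact absurd rfl hyz
  · rw [add_comm]
    exact add_mem_initialSums a hgt (by omega)

/-- A new term at least `2 * n`, after a dense initial segment, contributes many new sums. -/
theorem card_image_emod_of_dense (h : IncreasingUpTo a (n + 1)) (hdense : a n < 2 * n)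
    (hlarge : 2 * n ≤ a (n + 1)) :
    3 * n - a n ≤ ((initialSums a n).image (· % a (n + 1))).card := by
  have hn : IncreasingUpTo a n := h.mono n.le_succ
  have hn0 := hn.nonneg (i := n) le_rfl
  have hsub : (Finset.range (n + 1)).image a ∪ Finset.Ico (a n + 1) (2 * n) ⊆
      (initialSums a n).image (· % a (n + 1)) := by
    refine Finset.union_subset
      (h.image_subset_image_emod fun i hi => mem_initialSums a hi) fun x hx => ?_
    rw [Finset.mem_Ico] at hx
    exact Finset.mem_image.2 ⟨x, mem_initialSums_of_dense hn (by omega) hx.2,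
      Int.emod_eq_of_lt (by omega) (by omega)⟩
  have hdisj : Disjoint ((Finset.range (n + 1)).image a) (Finset.Ico (a n + 1) (2 * n)) := by
    rw [Finset.disjoint_left]
    intro x hx hx'
    obtain ⟨i, hi, rfl⟩ := Finset.mem_image.1 hx
    rw [Finset.mem_range] at hi
    rw [Finset.mem_Ico] at hx'
    have := hn.le (i := i) (by omega) le_rfl
    omega
  have hcard := Finset.card_le_card hsub
  rw [Finset.card_union_of_disjoint hdisj, hn.card_image, Int.card_Ico] at hcard
  omega

theorem two_mul_card_le_of_not_dvd {g : ℤ} (hg : ∀ i ≤ n, g ∣ a i) (hg' : ¬ g ∣ a (n + 1)) :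
    2 * (initialSums a n).card ≤ (initialSums a (n + 1)).card := by
  have hdisj : Disjoint (initialSums a n) ((initialSums a n).image (· + a (n + 1))) := by
    rw [Finset.disjoint_left]
    intro x hx hx'
    obtain ⟨y, hy, rfl⟩ := Finset.mem_image.1 hx'
    exact hg' ((dvd_add_right (dvd_of_mem_initialSums hg hy)).1 (dvd_of_mem_initialSums hg hx))
  rw [initialSums_succ, Finset.card_union_of_disjoint hdisj,
    Finset.card_image_of_injective _ (add_left_injective _), two_mul]

theorem two_mul_sub_two_le_sum_index (n : ℕ) :
    2 * (n : ℤ) - 2 ≤ ∑ i ∈ Finset.range (n + 1), (i : ℤ) := by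
  induction n with
  | zero => simp
  | succ n ih =>
    rw [Finset.sum_range_succ]
    have : 0 ≤ ∑ i ∈ Finset.range (n + 1), (i : ℤ) :=
      Finset.sum_nonneg fun i _ => Int.natCast_nonneg i
    push_cast
    omega

theorem card_initialSums_of_gcd_eq_one (h : IncreasingUpTo a n)
    (hgcd : (Finset.Icc 1 n).gcd a = 1) :
    (∑ i ∈ Finset.range (n + 1), (i : ℤ)) + 1 + min (a n - n) (n - 3) ≤
      (initialSums a n).card := by
  induction n with
  | zero =>
    have := sum_index_lt_card_initialSums h
    omega
  | succ n ih =>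
    have hn : IncreasingUpTo a n := h.mono n.le_succ
    have htriv := sum_index_lt_card_initialSums h
    have htriv' := sum_index_lt_card_initialSums hn
    have hsucc := card_initialSums_succ h
    rw [Finset.sum_range_succ] at htriv ⊢
    push_cast at htriv ⊢
    rcases Nat.lt_or_ge n 3 with hsmall | hn3
    · omega
    rcases le_or_gt (a (n + 1)) (2 * n - 1) with hdense | hlarge
    · have := card_image_emod_eq h hdense
      omega
    have hzero : a 0 = 0 := h.1
    by_cases hg : (Finset.Icc 1 n).gcd a = 1
    · have hih := ih hn hg
      have hgain : n + 1 < ((initialSums a n).image (· % a (n + 1))).card := by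
        by_contra! hcon
        have hap := eq_mul_of_card_image_emod_le h hn3 hcon
        have hunit : a 1 ∣ 1 := by
          rw [← hg]
          exact Finset.dvd_gcd fun i hi => ⟨i, by
            rw [Finset.mem_Icc] at hi
            rw [hap i (by omega), mul_comm]⟩
        have h1 : a 1 = 1 := Int.eq_one_of_dvd_one (hn.nonneg (by omega)) hunit
        have := hap (n + 1) le_rfl
        rw [h1] at this
        push_cast at this
        omega
      rcases le_or_gt (n - 3 : ℤ) (a n - n) with hcase | hcase
      · omega
      · have := card_image_emod_of_dense h (by omega) (by omega)
        omega
    · have hdvd : ∀ i ≤ n, (Finset.Icc 1 n).gcd a ∣ a i := by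
        intro i hi
        rcases Nat.eq_zero_or_pos i with rfl | hpos
        · rw [hzero]
          exact dvd_zero _
        · exact Finset.gcd_dvd (Finset.mem_Icc.2 ⟨hpos, hi⟩)
      have hndvd : ¬ (Finset.Icc 1 n).gcd a ∣ a (n + 1) := by
        intro hd
        apply hg
        have hone : (Finset.Icc 1 n).gcd a ∣ 1 := by
          rw [← hgcd]
          refine Finset.dvd_gcd fun i hi => ?_
          rw [Finset.mem_Icc] at hi
          rcases hi.2.eq_or_lt with rfl | hlt
          · exact hd
          · exact hdvd i (by omega)
        rw [← Finset.normalize_gcd]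
        exact normalize_eq_one.2 (isUnit_of_dvd_one hone)
      have := two_mul_card_le_of_not_dvd hdvd hndvd
      have := two_mul_sub_two_le_sum_index n
      omega

end

theorem card_subsetSums_add_replicate {a : ℕ → ℤ} {i : ℕ} (h : IncreasingUpTo a i)
    {M : Multiset ℤ} (hM : ∀ j < i, a j ∈ M) (t : ℕ) :
    (subsetSums M).card + i * t ≤ (subsetSums (M + Multiset.replicate t (a i))).card := by
  induction t with
  | zero => simp
  | succ t ih =>
    rw [Multiset.replicate_succ, Multiset.add_cons]
    refine le_trans ?_ (b := (subsetSums (M + Multiset.replicate t (a i))).card + i) ?_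
    · linarith
    rcases i with _ | n
    · rw [subsetSums_cons]
      exact Finset.card_le_card Finset.subset_union_left
    · have hpos := h.2 0 (n + 1) (by omega) le_rfl
      rw [h.1] at hpos
      refine le_trans (Nat.add_le_add_left ?_ _) (card_subsetSums_cons _ hpos)
      exact h.card_image_emod fun j hj =>
        mem_subsetSums_of_mem (Multiset.mem_add.2 (Or.inl (hM j (by omega))))

theorem card_subsetSums_add_sum_replicate {a : ℕ → ℤ} {n : ℕ} (h : IncreasingUpTo a n)
    {M : Multiset ℤ} (hM : ∀ j ≤ n, a j ∈ M) (t : ℕ → ℕ) :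
    (subsetSums M).card + ∑ i ∈ Finset.range (n + 1), i * t i ≤
      (subsetSums (M + ∑ i ∈ Finset.range (n + 1), Multiset.replicate (t i) (a i))).card := by
  suffices H : ∀ l ≤ n + 1, (subsetSums M).card + ∑ i ∈ Finset.range l, i * t i ≤
      (subsetSums (M + ∑ i ∈ Finset.range l, Multiset.replicate (t i) (a i))).card from
    H _ le_rfl
  intro l
  induction l with
  | zero => simp
  | succ l ih =>
    intro hl
    rw [Finset.sum_range_succ, Finset.sum_range_succ, ← add_assoc, ← add_assoc]
    refine (Nat.add_le_add_right (ih (by omega)) _).trans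
      (card_subsetSums_add_replicate (h.mono (by omega)) (fun j hj => ?_) (t l))
    exact Multiset.mem_add.2 (Or.inl (hM j (by omega)))

theorem card_initialSums_add_le_card_SeqSub {a : ℕ → ℤ} {n : ℕ} (h : IncreasingUpTo a n)
    {r : ℕ → ℕ} (hr : ∀ i ≤ n, 1 ≤ r i) :
    ((initialSums a n).card : ℤ) + ∑ i ∈ Finset.range (n + 1), (i : ℤ) * r i ≤
      (SeqSub (∑ i ∈ Finset.range (n + 1), Multiset.replicate (r i) (a i))).card +
        ∑ i ∈ Finset.range (n + 1), (i : ℤ) := by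
  have hsplit : ∑ i ∈ Finset.range (n + 1), Multiset.replicate (r i) (a i) =
      (Multiset.range (n + 1)).map a +
        ∑ i ∈ Finset.range (n + 1), Multiset.replicate (r i - 1) (a i) := by
    have hmap : (Multiset.range (n + 1)).map a = ∑ i ∈ Finset.range (n + 1), {a i} := by
      rw [← Multiset.sum_map_singleton ((Multiset.range (n + 1)).map a), Multiset.map_map]
      rfl
    rw [hmap, ← Finset.sum_add_distrib]
    refine Finset.sum_congr rfl fun i hi => ?_
    rw [← Multiset.replicate_one, ← Multiset.replicate_add,
      Nat.add_sub_cancel' (hr i (by rw [Finset.mem_range] at hi; omega))]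
  have hmem : ∀ j ≤ n, a j ∈ (Multiset.range (n + 1)).map a := fun j hj =>
    Multiset.mem_map_of_mem a (Multiset.mem_range.2 (by omega))
  have hzero : (0 : ℤ) ∈ (Multiset.range (n + 1)).map a := h.1 ▸ hmem 0 (by omega)
  have hcard := card_subsetSums_add_sum_replicate h hmem fun i => r i - 1
  rw [hsplit, SeqSub_eq_subsetSums (Multiset.mem_add.2 (Or.inl hzero))]
  have hsum : ∑ i ∈ Finset.range (n + 1), (i : ℤ) * r i =
      ((∑ i ∈ Finset.range (n + 1), i * (r i - 1) : ℕ) : ℤ) +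
        ∑ i ∈ Finset.range (n + 1), (i : ℤ) := by
    push_cast
    rw [← Finset.sum_add_distrib]
    refine Finset.sum_congr rfl fun i hi => ?_
    rw [Nat.cast_sub (hr i (by rw [Finset.mem_range] at hi; omega))]
    push_cast
    ring
  rw [hsum, initialSums]
  omega

theorem theta_lt : theta < 17 / 10 := by
  have : Real.sqrt 5 < 12 / 5 := by
    rw [Real.sqrt_lt' (by norm_num)]
    norm_num
  unfold theta
  linarith

theorem freiman_subsequence_sum_zero_min_one (k : ℕ) (hk : 2 ≤ k) (a : ℕ → ℤ) (r : ℕ → ℕ)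
    (h0 : a 0 = 0)
    (ha : ∀ i j, i < j → j ≤ k - 1 → a i < a j)
    (hr : ∀ i, i ≤ k - 1 → 1 ≤ r i)
    (hgcd : (Finset.Icc 1 (k - 1)).gcd a = 1)
    (hmin : (Finset.Icc 1 (k - 1)).inf' (Finset.nonempty_Icc.mpr (by omega)) r = 1) :
    (a (k - 1) ≤ 2 * (k : ℤ) - 5 →
      a (k - 1) - (k : ℤ) + 2 + ∑ i ∈ Finset.range k, (i : ℤ) * (r i : ℤ)
        ≤ ((SeqSub (∑ i ∈ Finset.range k, Multiset.replicate (r i) (a i))).card : ℤ)) ∧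
    (2 * (k : ℤ) - 4 ≤ a (k - 1) →
      theta * (k : ℝ) - (k : ℝ) - 2 + ∑ i ∈ Finset.range k, (i : ℝ) * (r i : ℝ)
        ≤ ((SeqSub (∑ i ∈ Finset.range k, Multiset.replicate (r i) (a i))).card : ℝ)) := by
  obtain ⟨n, rfl⟩ : ∃ n, k = n + 1 := ⟨k - 1, by omega⟩
  simp only [Nat.add_sub_cancel] at *
  have h : IncreasingUpTo a n := ⟨h0, ha⟩
  have hmain := card_initialSums_of_gcd_eq_one h hgcd
  have htriv := sum_index_lt_card_initialSums h
  have hseq := card_initialSums_add_le_card_SeqSub h hr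
  push_cast
  constructor
  · intro hsmall
    omega
  · intro hlarge
    have hbound : max 1 ((n : ℤ) - 2) + ∑ i ∈ Finset.range (n + 1), (i : ℤ) * r i ≤
        (SeqSub (∑ i ∈ Finset.range (n + 1), Multiset.replicate (r i) (a i))).card := by
      omega
    have hreal : max 1 ((n : ℝ) - 2) + ∑ i ∈ Finset.range (n + 1), (i : ℝ) * r i ≤
        (SeqSub (∑ i ∈ Finset.range (n + 1), Multiset.replicate (r i) (a i))).card := by
      exact_mod_cast hbound
    refine le_trans (add_le_add_left ?_ _) hreal
    have hθ := theta_lt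
    have hn : (1 : ℝ) ≤ n := by exact_mod_cast (by omega : 1 ≤ n)
    rcases le_total (n : ℝ) 3 with hle | hge
    · refine le_trans ?_ (le_max_left _ _)
      nlinarith
    · refine le_trans ?_ (le_max_right _ _)
      nlinarith
end
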